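/- arXiv:2011.10636 — 5 statements merged into one kernel-verified Lean document; each statement's English description precedes it below -/
import Mathlib

section
/- Under the λ-setup, assume the range of B equals Q', i.e. there is β > 0 with ‖B*q‖_{V'} ≥ β‖q‖_Q for all q ∈ Q, and let Λ > 0. Then for every λ ∈ (0,Λ], every f ∈ L¹(J;V') and every g ∈ L¹(J;Q'), Problem (P_λ) has exactly one solution (u,p) ∈ L¹(J;V) × L¹(J;Q), and there exist constants C₁, C₂, C₃, C₄ > 0 depending only on α₀, β, ‖a‖, ‖b‖, C_{k₁}, C_{k₂}, T and Λ — in particular independent of λ — such that ‖u‖_{L¹(J;V)} ≤ C₁‖f‖_{L¹(J;V')} + C₂‖g‖_{L¹(J;Q')} and ‖p‖_{L¹(J;Q)} ≤ C₃‖f‖_{L¹(J;V')} + C₄‖g‖_{L¹(J;Q')}. -/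
open MeasureTheory
open scoped RealInnerProductSpace

/-- `(u, p)` solves the parameter-dependent Problem (P_λ) with data `f`, `g`. -/
def SolvesPlam (V Q : Type) [NormedAddCommGroup V] [NormedSpace ℝ V]
    [NormedAddCommGroup Q] [InnerProductSpace ℝ Q] (T lam : ℝ)
    (a : V →L[ℝ] V →L[ℝ] ℝ) (b : V →L[ℝ] Q →L[ℝ] ℝ)
    (k₁ k₂ : ℝ → ℝ → ℝ) (f : ℝ → V →L[ℝ] ℝ) (g : ℝ → Q →L[ℝ] ℝ)
    (u : ℝ → V) (p : ℝ → Q) : Prop :=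
  ∀ᵐ t ∂volume, t ∈ Set.Icc (0:ℝ) T →
    (∀ v : V, a (u t) v + b v (p t)
        = f t v + ∫ s in (0:ℝ)..t, (k₁ t s * a (u s) v + k₂ t s * b v (p s))) ∧
    (∀ q : Q, b (u t) q - lam * ⟪p t, q⟫ = g t q)


theorem aux_riesz (H : Type) [NormedAddCommGroup H] [InnerProductSpace ℝ H] [CompleteSpace H] :
    ∃ r : (H →L[ℝ] ℝ) →L[ℝ] H, (∀ φ x, ⟪r φ, x⟫ = φ x) ∧ ∀ φ, ‖r φ‖ = ‖φ‖ := by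
  let r0 : (H →L[ℝ] ℝ) →ₗ[ℝ] H :=
    { toFun := fun φ => (InnerProductSpace.toDual ℝ H).symm φ
      map_add' := fun x y => map_add _ x y
      map_smul' := fun c x => by
        rw [map_smulₛₗ]; simp }
  have hn : ∀ φ, ‖r0 φ‖ = ‖φ‖ := fun φ => LinearIsometryEquiv.norm_map _ φ
  refine ⟨r0.mkContinuous 1 (fun φ => by rw [hn]; simp), ?_, ?_⟩
  · intro φ x
    exact InnerProductSpace.toDual_symm_apply
  · intro φ; exact hn φ

theorem aux_lm (H : Type) [NormedAddCommGroup H] [InnerProductSpace ℝ H] [CompleteSpace H]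
    (D : H →L[ℝ] H →L[ℝ] ℝ) (c : ℝ) (hc : 0 < c) (hD : ∀ v, c * ‖v‖ ^ 2 ≤ D v v)
    (φ : H →L[ℝ] ℝ) : ∃ u, D u = φ := by
  have co : IsCoercive D := ⟨c, hc, fun v => by have := hD v; nlinarith⟩
  obtain ⟨r, hr, -⟩ := aux_riesz H
  refine ⟨co.continuousLinearEquivOfBilin.symm (r φ), ?_⟩
  ext w
  rw [← co.continuousLinearEquivOfBilin_apply]
  simp [hr]

theorem aux_dec {V Q : Type}
    [NormedAddCommGroup V] [InnerProductSpace ℝ V] [CompleteSpace V]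
    [NormedAddCommGroup Q] [InnerProductSpace ℝ Q] [CompleteSpace Q]
    (b : V →L[ℝ] Q →L[ℝ] ℝ) (β : ℝ) (hβ : 0 < β) (hb : ∀ q : Q, β * ‖q‖ ≤ ‖b.flip q‖) (u : V) :
    ∃ u1 : V, b (u - u1) = 0 ∧ β * ‖u1‖ ≤ ‖b u‖ := by
  obtain ⟨r, hr, hn⟩ := aux_riesz V
  let Bt : Q →L[ℝ] V := r.comp b.flip
  have hBt : ∀ q v, ⟪Bt q, v⟫ = b v q := fun q v => hr _ _
  have hBn : ∀ q, β * ‖q‖ ≤ ‖Bt q‖ := fun q => by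
    show _ ≤ ‖r (b.flip q)‖
    rw [hn]; exact hb q
  have hself : ∀ q, b (Bt q) q = ‖Bt q‖ ^ 2 := fun q => by
    rw [← hBt, real_inner_self_eq_norm_sq]
  obtain ⟨q, hq⟩ := aux_lm Q (b.comp Bt) (β ^ 2) (by positivity) (fun q => by
    show _ ≤ b (Bt q) q
    rw [hself, ← mul_pow]
    exact pow_le_pow_left₀ (by positivity) (hBn q) 2) (b u)
  have hq' : b (Bt q) = b u := hq
  refine ⟨Bt q, by rw [map_sub, hq', sub_self], ?_⟩
  have h1 := hself q
  rw [hq'] at h1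
  have h2 := (b u).le_opNorm q
  have h3 := le_trans (le_abs_self _) h2
  have h4 := hBn q
  rcases (norm_nonneg (Bt q)).eq_or_lt with h0 | h0
  · rw [← h0]; simp
  · have : ‖Bt q‖ * (β * ‖Bt q‖) ≤ ‖Bt q‖ * ‖b u‖ := by
      have h5 : β * ‖Bt q‖ ^ 2 ≤ ‖b u‖ * (β * ‖q‖) := by rw [← h1]; nlinarith
      have h6 := mul_le_mul_of_nonneg_left h4 (norm_nonneg (b u))
      nlinarith
    exact le_of_mul_le_mul_left this h0

theorem aux_cs {V : Type} [NormedAddCommGroup V] [InnerProductSpace ℝ V]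
    (a : V →L[ℝ] V →L[ℝ] ℝ) (Na : ℝ) (hs : ∀ v w : V, a v w = a w v)
    (hp : ∀ v : V, 0 ≤ a v v) (ha : ‖a‖ ≤ Na) (u v : V) :
    (a u v) ^ 2 ≤ a u u * a v v ∧ a v v ≤ Na * ‖v‖ ^ 2 := by
  constructor
  · have key : ∀ x : ℝ, 0 ≤ a v v * (x * x) + (2 * a u v) * x + a u u := by
      intro x
      have := hp (u + x • v)
      simp only [map_add, map_smul, add_apply, smul_apply,
        smul_eq_mul] at this
      rw [hs v u] at this
      linarith
    have := discrim_le_zero key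
    rw [discrim] at this
    nlinarith
  · have h := le_trans (le_abs_self _) (a.le_opNorm₂ v v)
    have : ‖a‖ * ‖v‖ * ‖v‖ ≤ Na * ‖v‖ * ‖v‖ := by gcongr
    nlinarith

/-- coercivity -/
theorem aux_u {V Q : Type}
    [NormedAddCommGroup V] [InnerProductSpace ℝ V] [CompleteSpace V]
    [NormedAddCommGroup Q] [InnerProductSpace ℝ Q] [CompleteSpace Q]
    (α₀ β Na : ℝ) (hα₀ : 0 < α₀) (hβ : 0 < β) (hNa : 0 ≤ Na)
    (a : V →L[ℝ] V →L[ℝ] ℝ) (b : V →L[ℝ] Q →L[ℝ] ℝ)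
    (hs : ∀ v w : V, a v w = a w v) (hp : ∀ v : V, 0 ≤ a v v) (ha : ‖a‖ ≤ Na)
    (hc : ∀ v ∈ LinearMap.ker b.toLinearMap, α₀ * ‖v‖ ^ 2 ≤ a v v)
    (hb : ∀ q : Q, β * ‖q‖ ≤ ‖b.flip q‖) (u : V) :
    ‖u‖ ^ 2 ≤ (4 / α₀) * a u u + ((2 + 4 * Na / α₀) / β ^ 2) * ‖b u‖ ^ 2 := by
  obtain ⟨u1, h0, h1⟩ := aux_dec b β hβ hb u
  have h2 := hc (u - u1) h0
  have h3 := hp (u + (-1 : ℝ) • u1 + (2:ℝ) • u1)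
  have h4 := (aux_cs a Na hs hp ha u u1).2
  have h5 : a (u - u1) (u - u1) ≤ 2 * a u u + 2 * (Na * ‖u1‖ ^ 2) := by
    simp only [map_add, map_sub, map_smul, add_apply,
      sub_apply, smul_apply, smul_eq_mul] at h3 ⊢
    linarith
  have h6 : ‖u‖ ^ 2 ≤ 2 * ‖u - u1‖ ^ 2 + 2 * ‖u1‖ ^ 2 := by
    have h7 : ‖u‖ ≤ ‖u - u1‖ + ‖u1‖ := by simpa using norm_add_le (u - u1) u1
    have := pow_le_pow_left₀ (norm_nonneg u) h7 2
    nlinarith [sq_nonneg (‖u - u1‖ - ‖u1‖)]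
  have h8 : ‖u1‖ ^ 2 ≤ ‖b u‖ ^ 2 / β ^ 2 := by
    rw [le_div_iff₀ (by positivity)]
    have := pow_le_pow_left₀ (by positivity) h1 2
    nlinarith
  have h9 : ‖u - u1‖ ^ 2 ≤ (2 * a u u + 2 * (Na * ‖u1‖ ^ 2)) / α₀ := by
    rw [le_div_iff₀ hα₀]; linarith
  calc ‖u‖ ^ 2 ≤ 2 * ((2 * a u u + 2 * (Na * ‖u1‖ ^ 2)) / α₀) + 2 * ‖u1‖ ^ 2 := by linarith
    _ = (4 / α₀) * a u u + (2 + 4 * Na / α₀) * ‖u1‖ ^ 2 := by field_simp; ring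
    _ ≤ (4 / α₀) * a u u + (2 + 4 * Na / α₀) * (‖b u‖ ^ 2 / β ^ 2) := by gcongr
    _ = _ := by ring

set_option maxHeartbeats 1600000 in
/-- uniform estimate, scalar part -/
theorem aux_scalar (α₀ β Na Lam : ℝ) (hα₀ : 0 < α₀) (hβ : 0 < β) (hNa : 0 ≤ Na) (hLam : 0 < Lam) :
    ∃ c : ℝ, 0 < c ∧ ∀ X U P Bu N lam : ℝ, 0 ≤ X → 0 ≤ U → 0 ≤ P → 0 ≤ Bu → 0 ≤ N →
      0 ≤ lam → lam ≤ Lam →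
      U ^ 2 ≤ (4 / α₀) * X ^ 2 + ((2 + 4 * Na / α₀) / β ^ 2) * Bu ^ 2 →
      Bu ≤ N + lam * P → β * P ≤ N + √Na * X → X ^ 2 ≤ N * U + N * P →
      U ≤ c * N ∧ P ≤ c * N := by
  obtain ⟨A, hA, hA'⟩ : ∃ A, 0 < A ∧ A = 4 / α₀ := ⟨_, by positivity, rfl⟩
  obtain ⟨E, hE, hE'⟩ : ∃ E, 0 < E ∧ E = ((2 + 4 * Na / α₀) / β ^ 2) := ⟨_, by positivity, rfl⟩
  rw [← hA', ← hE']
  set m := (1 + √Na) / β with hm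
  have hm0 : 0 < m := by positivity
  -- P ≤ m (N+X), Bu ≤ (1+Lam m)(N+X), U ≤ d (N+X)
  set d := 1 + A + E * (1 + Lam * m) ^ 2 with hd
  have hd0 : 0 < d := by positivity
  set e := d + m with he
  have he0 : 0 < e := by positivity
  -- X^2 ≤ e N (N+X)
  refine ⟨e * (2 + e), by positivity, ?_⟩
  intro X U P Bu N lam hX hU hP hBu hN hl hlL h1 h2 h3 h4
  have hPm : P ≤ m * (N + X) := by
    rw [hm, div_mul_eq_mul_div, le_div_iff₀ hβ]
    have := Real.sqrt_nonneg Na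
    nlinarith [mul_nonneg this hN]
  have hB : Bu ≤ (1 + Lam * m) * (N + X) := by
    have : lam * P ≤ Lam * (m * (N + X)) := by gcongr
    nlinarith
  have hUd : U ≤ d * (N + X) := by
    have hB2 := pow_le_pow_left₀ hBu hB 2
    have : U ^ 2 ≤ (d * (N + X)) ^ 2 := by
      have h5 : X ^ 2 ≤ (N + X) ^ 2 := by nlinarith
      calc U ^ 2 ≤ A * (N + X) ^ 2 + E * ((1 + Lam * m) * (N + X)) ^ 2 := by
            refine h1.trans ?_; gcongr
        _ = (d - 1) * (N + X) ^ 2 := by rw [hd]; ring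
        _ ≤ d ^ 2 * (N + X) ^ 2 := by gcongr; nlinarith [sq_nonneg (d - 1)]
        _ = _ := by ring
    exact le_of_sq_le_sq this (by positivity)
  have hXe : X ^ 2 ≤ e * N * (N + X) := by
    have : N * U + N * P ≤ N * (d * (N + X)) + N * (m * (N + X)) := by gcongr
    calc X ^ 2 ≤ N * (d * (N + X)) + N * (m * (N + X)) := h4.trans this
      _ = e * N * (N + X) := by rw [he]; ring
  have hXN : X ≤ (1 + e) * N := by
    by_contra hcon
    push Not at hcon
    have hNX : N < X := by nlinarith [mul_nonneg he0.le hN]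
    have q3 : 0 < X * (X - (1 + e) * N) := mul_pos (hN.trans_lt hNX) (sub_pos.2 hcon)
    have q4 : 0 ≤ N * (X - (1 + e) * N) := mul_nonneg hN (sub_pos.2 hcon).le
    have q6 : 0 ≤ N * N := mul_nonneg hN hN
    ring_nf at q3 q4 q6 hXe
    linarith
  have hNX : N + X ≤ (2 + e) * N := by linarith
  constructor
  · calc U ≤ d * (N + X) := hUd
      _ ≤ e * ((2 + e) * N) := by gcongr; linarith
      _ = _ := by ring
  · calc P ≤ m * (N + X) := hPm
      _ ≤ e * ((2 + e) * N) := by gcongr; linarith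
      _ = _ := by ring

theorem aux_static (α₀ β Na Lam : ℝ) (hα₀ : 0 < α₀) (hβ : 0 < β) (hNa : 0 ≤ Na) (hLam : 0 < Lam) :
    ∃ c : ℝ, 0 < c ∧ ∀ (V Q : Type)
        [NormedAddCommGroup V] [InnerProductSpace ℝ V] [CompleteSpace V]
        [NormedAddCommGroup Q] [InnerProductSpace ℝ Q] [CompleteSpace Q]
        (a : V →L[ℝ] V →L[ℝ] ℝ) (b : V →L[ℝ] Q →L[ℝ] ℝ),
        (∀ v w : V, a v w = a w v) → (∀ v : V, 0 ≤ a v v) →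
        ‖a‖ ≤ Na →
        (∀ v ∈ LinearMap.ker b.toLinearMap, α₀ * ‖v‖ ^ 2 ≤ a v v) →
        (∀ q : Q, β * ‖q‖ ≤ ‖b.flip q‖) →
        ∀ lam : ℝ, 0 < lam → lam ≤ Lam →
        ∃ S : ((V →L[ℝ] ℝ) × (Q →L[ℝ] ℝ)) →L[ℝ] V × Q, ‖S‖ ≤ c ∧
          ∀ (u : V) (p : Q) (F : V →L[ℝ] ℝ) (G : Q →L[ℝ] ℝ),
            ((∀ v, a u v + b v p = F v) ∧ (∀ q, b u q - lam * ⟪p, q⟫ = G q)) ↔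
              (u, p) = S (F, G) := by
  obtain ⟨c, hc, hsc⟩ := aux_scalar α₀ β Na Lam hα₀ hβ hNa hLam
  refine ⟨c, hc, ?_⟩
  intro V Q _ _ _ _ _ _ a b hs hp ha hco hb lam hlam hlL
  have hest : ∀ (u : V) (p : Q) (F : V →L[ℝ] ℝ) (G : Q →L[ℝ] ℝ),
      (∀ v, a u v + b v p = F v) → (∀ q, b u q - lam * ⟪p, q⟫ = G q) →
      ‖(u, p)‖ ≤ c * ‖(F, G)‖ := by
    intro u p F G h1 h2
    set N := ‖(F, G)‖ with hN
    have hF : ‖F‖ ≤ N := norm_fst_le (F, G)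
    have hG : ‖G‖ ≤ N := norm_snd_le (F, G)
    have hN0 : 0 ≤ N := norm_nonneg _
    have hX : √(a u u) ^ 2 = a u u := Real.sq_sqrt (hp u)
    have := hsc (√(a u u)) ‖u‖ ‖p‖ ‖b u‖ N lam (Real.sqrt_nonneg _) (norm_nonneg _) (norm_nonneg _)
      (norm_nonneg _) hN0 hlam.le hlL
      (by rw [hX]; exact aux_u α₀ β Na hα₀ hβ hNa a b hs hp ha hco hb u)
      (by
        refine ContinuousLinearMap.opNorm_le_bound _ (by positivity) (fun q => ?_)
        have e1 : b u q = G q + lam * ⟪p, q⟫ := by rw [← h2 q]; ring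
        rw [e1]
        refine (norm_add_le _ _).trans ?_
        rw [norm_mul, Real.norm_of_nonneg hlam.le]
        have e2 := G.le_opNorm q
        have e3 := norm_inner_le_norm (𝕜 := ℝ) p q
        have e4 : ‖G‖ * ‖q‖ ≤ N * ‖q‖ := by gcongr
        nlinarith [mul_le_mul_of_nonneg_left e3 hlam.le])
      (by
        refine (hb p).trans ?_
        refine ContinuousLinearMap.opNorm_le_bound _ (by positivity) (fun v => ?_)
        have e1 : b.flip p v = F v - a u v := by rw [← h1 v]; simp
        rw [e1]
        refine (norm_sub_le _ _).trans ?_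
        have e2 := F.le_opNorm v
        have e4 : ‖F‖ * ‖v‖ ≤ N * ‖v‖ := by gcongr
        have e5 : ‖a u v‖ ≤ √Na * √(a u u) * ‖v‖ := by
          obtain ⟨c1, c2⟩ := aux_cs a Na hs hp ha u v
          rw [Real.norm_eq_abs]
          apply abs_le_of_sq_le_sq _ (by positivity)
          rw [mul_pow, mul_pow, hX, Real.sq_sqrt hNa]
          have := mul_le_mul_of_nonneg_left c2 (hp u)
          nlinarith
        nlinarith)
      (by
        rw [hX]
        have e1 := h1 u
        have e2 := h2 p
        have e3 : 0 ≤ ⟪p, p⟫ := real_inner_self_nonneg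
        have e4 : F u ≤ N * ‖u‖ := (le_abs_self _).trans ((F.le_opNorm u).trans (by gcongr))
        have e5 : -G p ≤ N * ‖p‖ := (neg_le_abs _).trans ((G.le_opNorm p).trans (by gcongr))
        nlinarith [mul_nonneg hlam.le e3])
    exact max_le this.1 this.2
  have hex : ∀ (F : V →L[ℝ] ℝ) (G : Q →L[ℝ] ℝ), ∃ (u : V) (p : Q),
      (∀ v, a u v + b v p = F v) ∧ (∀ q, b u q - lam * ⟪p, q⟫ = G q) := by
    intro F G
    obtain ⟨r, hr, hrn⟩ := aux_riesz Q
    let D : V →L[ℝ] V →L[ℝ] ℝ := a + lam⁻¹ • (b.flip.comp (r.comp b))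
    have hD : ∀ u v, D u v = a u v + lam⁻¹ * b v (r (b u)) := fun u v => rfl
    set A := 4 / α₀ with hA
    set E := ((2 + 4 * Na / α₀) / β ^ 2) with hE
    have hA0 : 0 < A := by positivity
    have hE0 : 0 < E := by positivity
    have hDc : ∀ v, (A + E * lam)⁻¹ * ‖v‖ ^ 2 ≤ D v v := by
      intro v
      have e1 := aux_u α₀ β Na hα₀ hβ hNa a b hs hp ha hco hb v
      rw [← hA, ← hE] at e1
      have e2 : b v (r (b v)) = ‖b v‖ ^ 2 := by
        rw [← hr, real_inner_self_eq_norm_sq, hrn]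
      rw [hD, e2, inv_mul_le_iff₀ (by positivity)]
      refine e1.trans ?_
      have e3 := hp v
      have : (A + E * lam) * (a v v + lam⁻¹ * ‖b v‖ ^ 2)
        = A * a v v + E * ‖b v‖ ^ 2 + (E * lam * a v v + A * (lam⁻¹ * ‖b v‖ ^ 2)) := by
        field_simp; ring
      rw [this]
      have : 0 ≤ E * lam * a v v + A * (lam⁻¹ * ‖b v‖ ^ 2) := by positivity
      linarith
    obtain ⟨u, hu⟩ := aux_lm V D _ (by positivity) hDc (F + lam⁻¹ • b.flip (r G))
    refine ⟨u, lam⁻¹ • (r (b u) - r G), ?_, ?_⟩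
    · intro v
      have := congrArg (fun φ => φ v) hu
      simp only [hD, add_apply, smul_apply,
        ContinuousLinearMap.flip_apply, smul_eq_mul] at this
      simp only [map_smul, map_sub, smul_eq_mul]
      linarith
    · intro q
      rw [real_inner_smul_left, inner_sub_left, hr, hr]
      field_simp
      ring
  choose su sp h1 h2 using hex
  have huniq : ∀ (u : V) (p : Q) (F : V →L[ℝ] ℝ) (G : Q →L[ℝ] ℝ),
      (∀ v, a u v + b v p = F v) → (∀ q, b u q - lam * ⟪p, q⟫ = G q) →
      (u, p) = (su F G, sp F G) := by
    intro u p F G e1 e2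
    have := hest (u - su F G) (p - sp F G) 0 0
      (fun v => by
        have := e1 v; have := h1 F G v
        simp only [map_sub, sub_apply, zero_apply]
        linarith)
      (fun q => by
        have := e2 q; have := h2 F G q
        simp only [map_sub, sub_apply, zero_apply,
          inner_sub_left]
        linarith)
    have h0 : ‖((u, p) : V × Q) - (su F G, sp F G)‖ ≤ 0 := by simpa using this
    exact sub_eq_zero.1 (norm_le_zero_iff.1 h0)
  let S0 : ((V →L[ℝ] ℝ) × (Q →L[ℝ] ℝ)) →ₗ[ℝ] V × Q :=
    { toFun := fun x => (su x.1 x.2, sp x.1 x.2)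
      map_add' := fun x y => by
        symm
        refine huniq (su x.1 x.2 + su y.1 y.2) (sp x.1 x.2 + sp y.1 y.2) _ _ ?_ ?_
        · intro v
          have := h1 x.1 x.2 v; have := h1 y.1 y.2 v
          simp only [map_add, add_apply, Prod.fst_add]
          linarith
        · intro q
          have := h2 x.1 x.2 q; have := h2 y.1 y.2 q
          simp only [map_add, add_apply, Prod.snd_add, inner_add_left]
          linarith
      map_smul' := fun k x => by
        symm
        refine huniq (k • su x.1 x.2) (k • sp x.1 x.2) _ _ ?_ ?_
        · intro v
          have := h1 x.1 x.2 v
          simp only [map_smul, smul_apply, Prod.smul_fst, smul_eq_mul, ← this]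
          ring
        · intro q
          have := h2 x.1 x.2 q
          simp only [map_smul, smul_apply, Prod.smul_snd, smul_eq_mul, ← this,
            real_inner_smul_left]
          ring }
  refine ⟨S0.mkContinuous c (fun x => hest _ _ x.1 x.2 (h1 _ _) (h2 _ _)),
    LinearMap.mkContinuous_norm_le _ hc.le _, ?_⟩
  intro u p F G
  constructor
  · rintro ⟨e1, e2⟩
    exact huniq u p F G e1 e2
  · intro h
    have h' : (u, p) = (su F G, sp F G) := h
    obtain ⟨rfl, rfl⟩ := Prod.mk.inj h'
    exact ⟨h1 F G, h2 F G⟩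

section Volt
set_option linter.unusedSectionVars false
variable {W : Type} [NormedAddCommGroup W] [NormedSpace ℝ W] [CompleteSpace W]

theorem aux_K {ν : Measure ℝ} [IsFiniteMeasure ν] {N : ℝ → ℝ → W →L[ℝ] W} {L : ℝ}
    (hN : StronglyMeasurable (Function.uncurry N)) (hL : ∀ t s, ‖N t s‖ ≤ L)
    (hh : ∀ s, ∫ t, ‖N t s‖ ∂ν ≤ 1 / 2) {w : ℝ → W} (hw : Integrable w ν) :
    (∀ t, Integrable (fun s => N t s (w s)) ν) ∧
    Integrable (fun t => ∫ s, N t s (w s) ∂ν) ν ∧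
    ∫ t, ‖∫ s, N t s (w s) ∂ν‖ ∂ν ≤ (1 / 2) * ∫ s, ‖w s‖ ∂ν := by
  have hL0 : 0 ≤ L := (norm_nonneg _).trans (hL 0 0)
  have h1 : ∀ t, Integrable (fun s => N t s (w s)) ν := by
    intro t
    refine (hw.norm.const_mul L).mono' ?_ (ae_of_all _ fun s => ?_)
    · have : StronglyMeasurable (N t) := hN.comp_measurable measurable_prodMk_left
      exact (isBoundedBilinearMap_apply (𝕜 := ℝ) (E := W) (F := W)).continuous.comp_aestronglyMeasurable
        (this.aestronglyMeasurable.prodMk hw.1)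
    · exact (N t s).le_of_opNorm_le (hL t s) _
  have h2 : Integrable (Function.uncurry fun t s => N t s (w s)) (ν.prod ν) := by
    refine ((hw.norm.comp_snd ν).const_mul L).mono' ?_ (ae_of_all _ fun x => ?_)
    · exact (isBoundedBilinearMap_apply (𝕜 := ℝ) (E := W) (F := W)).continuous.comp_aestronglyMeasurable
        (hN.aestronglyMeasurable.prodMk hw.1.comp_snd)
    · exact (N x.1 x.2).le_of_opNorm_le (hL _ _) _
  refine ⟨h1, h2.integral_prod_left, ?_⟩
  calc ∫ t, ‖∫ s, N t s (w s) ∂ν‖ ∂ν ≤ ∫ t, ∫ s, ‖N t s (w s)‖ ∂ν ∂ν :=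
        integral_mono h2.integral_prod_left.norm h2.norm.integral_prod_left
          (fun t => norm_integral_le_integral_norm _)
    _ = ∫ s, ∫ t, ‖N t s (w s)‖ ∂ν ∂ν := integral_integral_swap h2.norm
    _ ≤ ∫ s, (1 / 2) * ‖w s‖ ∂ν := by
        refine integral_mono_ae h2.norm.integral_prod_right (hw.norm.const_mul _) ?_
        filter_upwards [h2.norm.prod_left_ae] with s hs
        have hNs : Integrable (fun t => ‖N t s‖) ν := by
          refine (integrable_const L).mono' ?_ (ae_of_all _ fun t => by simpa using hL t s)
          have : StronglyMeasurable (fun t => N t s) := hN.comp_measurable measurable_prodMk_right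
          exact this.norm.aestronglyMeasurable
        calc ∫ t, ‖N t s (w s)‖ ∂ν ≤ ∫ t, ‖N t s‖ * ‖w s‖ ∂ν :=
              integral_mono hs (hNs.mul_const _) (fun t => (N t s).le_opNorm _)
          _ = (∫ t, ‖N t s‖ ∂ν) * ‖w s‖ := integral_mul_const _ _
          _ ≤ _ := by gcongr; exact hh s
    _ = _ := integral_const_mul _ _

theorem aux_bound {ν : Measure ℝ} [IsFiniteMeasure ν] {N : ℝ → ℝ → W →L[ℝ] W} {L : ℝ}
    (hN : StronglyMeasurable (Function.uncurry N)) (hL : ∀ t s, ‖N t s‖ ≤ L)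
    (hh : ∀ s, ∫ t, ‖N t s‖ ∂ν ≤ 1 / 2) {w h : ℝ → W} (hw : Integrable w ν) (hi : Integrable h ν)
    (he : ∀ᵐ t ∂ν, w t = h t + ∫ s, N t s (w s) ∂ν) :
    ∫ t, ‖w t‖ ∂ν ≤ 2 * ∫ t, ‖h t‖ ∂ν := by
  obtain ⟨-, h2, h3⟩ := aux_K hN hL hh hw
  have : ∫ t, ‖w t‖ ∂ν ≤ ∫ t, (‖h t‖ + ‖∫ s, N t s (w s) ∂ν‖) ∂ν := by
    refine integral_mono_ae hw.norm (hi.norm.add h2.norm) ?_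
    filter_upwards [he] with t ht
    have := norm_add_le (h t) (∫ s, N t s (w s) ∂ν)
    rwa [← ht] at this
  rw [integral_add hi.norm h2.norm] at this
  linarith

theorem aux_exist {ν : Measure ℝ} [IsFiniteMeasure ν] {N : ℝ → ℝ → W →L[ℝ] W} {L : ℝ}
    (hN : StronglyMeasurable (Function.uncurry N)) (hL : ∀ t s, ‖N t s‖ ≤ L)
    (hh : ∀ s, ∫ t, ‖N t s‖ ∂ν ≤ 1 / 2) {h : ℝ → W} (hi : Integrable h ν) :
    ∃ w : ℝ → W, Integrable w ν ∧ ∀ᵐ t ∂ν, w t = h t + ∫ s, N t s (w s) ∂ν := by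
  have hint : ∀ w : Lp W 1 ν, Integrable (fun t => h t + ∫ s, N t s (w s) ∂ν) ν := fun w =>
    hi.add (aux_K hN hL hh (L1.integrable_coeFn w)).2.1
  let Φ : Lp W 1 ν → Lp W 1 ν := fun w => (hint w).toL1 _
  have hΦ : ContractingWith (1 / 2) Φ := by
    refine ⟨by rw [one_div, ← NNReal.coe_lt_coe]; norm_num, LipschitzWith.of_dist_le_mul fun w w' => ?_⟩
    have i1 := L1.integrable_coeFn w
    have i2 := L1.integrable_coeFn w'
    rw [dist_eq_norm, dist_eq_norm]
    show ‖(hint w).toL1 _ - (hint w').toL1 _‖ ≤ _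
    rw [← Integrable.toL1_sub, L1.norm_eq_integral_norm, L1.norm_eq_integral_norm]
    have k := (aux_K hN hL hh (i1.sub i2)).2.2
    have e1 : ∫ t, ‖(w - w' : Lp W 1 ν) t‖ ∂ν = ∫ t, ‖(⇑w - ⇑w') t‖ ∂ν := by
      refine integral_congr_ae ?_
      filter_upwards [Lp.coeFn_sub w w'] with t ht
      rw [ht]
    rw [e1]
    refine le_trans (le_of_eq ?_) (k.trans (le_of_eq ?_))
    · refine integral_congr_ae ?_
      filter_upwards [((hint w).sub (hint w')).coeFn_toL1] with t ht
      rw [ht]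
      have j1 := (aux_K hN hL hh i1).1 t
      have j2 := (aux_K hN hL hh i2).1 t
      simp only [Pi.sub_apply, map_sub]
      rw [integral_sub j1 j2]
      congr 1
      abel
    · simp
  obtain ⟨w, hw⟩ : ∃ w, Φ w = w := ⟨_, hΦ.fixedPoint_isFixedPt⟩
  refine ⟨w, L1.integrable_coeFn w, ?_⟩
  filter_upwards [(hint w).coeFn_toL1] with t ht
  rw [← ht]
  show w t = Φ w t
  rw [hw]

theorem aux_exp (T L s : ℝ) (hT : 0 < T) (hL : 0 ≤ L) (hs : s ≤ T) :
    ∫ t in Set.Ioc s T, L * Real.exp (-(2 * L + 1) * (t - s)) ≤ 1 / 2 := by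
  rw [← intervalIntegral.integral_of_le hs]
  have hd : ∀ t ∈ Set.uIcc s T, HasDerivAt
      (fun t => -(L / (2 * L + 1)) * Real.exp (-(2 * L + 1) * (t - s)))
      (L * Real.exp (-(2 * L + 1) * (t - s))) t := by
    intro t _
    have := ((((hasDerivAt_id t).sub_const s).const_mul (-(2 * L + 1))).exp).const_mul
      (-(L / (2 * L + 1)))
    have h0 : 2 * L + 1 ≠ 0 := by positivity
    refine HasDerivAt.congr_deriv this ?_
    symm
    show _ = -(L / (2 * L + 1)) * (Real.exp (-(2 * L + 1) * (t - s)) * (-(2 * L + 1) * 1))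
    generalize Real.exp _ = y
    field_simp
  rw [intervalIntegral.integral_eq_sub_of_hasDerivAt hd
    (Continuous.intervalIntegrable (by fun_prop) _ _)]
  have h1 := Real.exp_pos (-(2 * L + 1) * (T - s))
  have h2 : L / (2 * L + 1) ≤ 1 / 2 := by
    rw [div_le_div_iff₀ (by positivity) (by norm_num)]; linarith
  have h3 : 0 ≤ L / (2 * L + 1) := by positivity
  simp only [sub_self, mul_zero, Real.exp_zero, mul_one]
  nlinarith [mul_nonneg h3 h1.le]

/-- Volterra equations with bounded kernel -/
theorem aux_volterra (T L : ℝ) (hT : 0 < T) (K : ℝ → ℝ → W →L[ℝ] W)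
    (hK : StronglyMeasurable (Function.uncurry K)) (hL : ∀ t s, ‖K t s‖ ≤ L)
    (hK0 : ∀ t s, t < s → K t s = 0) (h : ℝ → W)
    (hi : IntegrableOn h (Set.Ioc 0 T)) :
    ∃ w : ℝ → W, IntegrableOn w (Set.Ioc 0 T) ∧
      (∀ᵐ t ∂(volume.restrict (Set.Ioc 0 T)), w t = h t + ∫ s in Set.Ioc 0 T, K t s (w s)) ∧
      (∀ w' : ℝ → W, IntegrableOn w' (Set.Ioc 0 T) →
        (∀ᵐ t ∂(volume.restrict (Set.Ioc 0 T)), w' t = h t + ∫ s in Set.Ioc 0 T, K t s (w' s)) →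
        w' =ᵐ[volume.restrict (Set.Ioc 0 T)] w) ∧
      ∫ t in Set.Ioc 0 T, ‖w t‖ ≤
        2 * Real.exp ((2 * L + 1) * T) * ∫ t in Set.Ioc 0 T, ‖h t‖ := by
  have hL0 : 0 ≤ L := (norm_nonneg _).trans (hL 0 0)
  set ν := volume.restrict (Set.Ioc 0 T) with hν
  set σ := 2 * L + 1 with hσ
  -- on times in (0,T], weight truncated
  let N : ℝ → ℝ → W →L[ℝ] W := fun t s =>
    (if t ∈ Set.Ioc 0 T ∧ s ∈ Set.Ioc 0 T then Real.exp (-σ * (t - s)) else 0) • K t s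
  have hNm : StronglyMeasurable (Function.uncurry N) := by
    have : Measurable (fun x : ℝ × ℝ =>
        if x.1 ∈ Set.Ioc 0 T ∧ x.2 ∈ Set.Ioc 0 T then Real.exp (-σ * (x.1 - x.2)) else 0) := by
      refine Measurable.ite ?_ (by fun_prop) measurable_const
      exact (measurable_fst measurableSet_Ioc).inter (measurable_snd measurableSet_Ioc)
    exact this.stronglyMeasurable.smul hK
  have hNb : ∀ t s, ‖N t s‖ ≤ (Set.Ioc s T).indicator (fun t => L * Real.exp (-σ * (t - s))) t
      ∨ t = s := by
    intro t s
    by_cases hts : t = s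
    · right; exact hts
    left
    simp only [N, norm_smul]
    rcases lt_or_gt_of_ne hts with h1 | h1
    · rw [hK0 t s h1]
      simp only [norm_zero, mul_zero]
      apply Set.indicator_nonneg
      intro t _; positivity
    · split_ifs with h2
      · rw [Set.indicator_of_mem (show t ∈ Set.Ioc s T from ⟨h1, h2.1.2⟩),
          Real.norm_of_nonneg (Real.exp_pos _).le, mul_comm]
        gcongr; exact hL t s
      · simp only [norm_zero, zero_mul]
        apply Set.indicator_nonneg
        intro t _; positivity
  have hNL : ∀ t s, ‖N t s‖ ≤ L := by
    intro t s
    simp only [N, norm_smul]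
    rcases lt_or_ge t s with h1 | h1
    · rw [hK0 t s h1]; simpa using hL0
    · have : ‖(if t ∈ Set.Ioc 0 T ∧ s ∈ Set.Ioc 0 T then Real.exp (-σ * (t - s)) else 0)‖ ≤ 1 := by
        split_ifs
        · rw [Real.norm_of_nonneg (Real.exp_pos _).le, Real.exp_le_one_iff]
          have : 0 ≤ σ * (t - s) := mul_nonneg (by positivity) (by linarith)
          linarith
        · simp
      calc _ ≤ 1 * L := by gcongr; exact hL t s
        _ = L := one_mul L
  have hNh : ∀ s, ∫ t, ‖N t s‖ ∂ν ≤ 1 / 2 := by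
    intro s
    by_cases hs : s ∈ Set.Ioc 0 T
    · have hne : ∀ᵐ t ∂ν, t ≠ s := ae_restrict_of_ae (Measure.ae_ne volume s)
      have hint : IntegrableOn (fun t => L * Real.exp (-σ * (t - s))) (Set.Ioc s T) :=
        (Continuous.integrableOn_Icc (by fun_prop)).mono_set Set.Ioc_subset_Icc_self
      calc ∫ t, ‖N t s‖ ∂ν
          ≤ ∫ t, (Set.Ioc s T).indicator (fun t => L * Real.exp (-σ * (t - s))) t ∂ν := by
            refine integral_mono_of_nonneg (ae_of_all _ fun _ => norm_nonneg _) ?_ ?_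
            · exact (hint.integrable_indicator measurableSet_Ioc).restrict
            · filter_upwards [hne] with t ht
              exact (hNb t s).resolve_right ht
        _ ≤ ∫ t, (Set.Ioc s T).indicator (fun t => L * Real.exp (-σ * (t - s))) t := by
            refine setIntegral_le_integral (hint.integrable_indicator measurableSet_Ioc)
              (ae_of_all _ fun t => ?_)
            apply Set.indicator_nonneg
            intro t _; positivity
        _ = ∫ t in Set.Ioc s T, L * Real.exp (-σ * (t - s)) := integral_indicator measurableSet_Ioc
        _ ≤ 1 / 2 := aux_exp T L s hT hL0 hs.2
    · have : ∀ t, N t s = 0 := fun t => by simp only [N]; rw [if_neg (fun hh => hs hh.2), zero_smul]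
      simp [this]
  -- weights preserve integrability
  have hwt : ∀ (c : ℝ) (w : ℝ → W), Integrable w ν → Integrable (fun t => Real.exp (c * t) • w t) ν := by
    intro c w hw
    have : IntegrableOn (fun t => Real.exp (c * t) • w t) (Set.Ioc 0 T) := by
      refine Integrable.bdd_smul (C := Real.exp (|c| * T)) hw ?_ ?_
      · exact (Continuous.aestronglyMeasurable (by fun_prop))
      · filter_upwards [ae_restrict_mem measurableSet_Ioc] with t ht
        rw [Real.norm_of_nonneg (Real.exp_pos _).le]
        apply Real.exp_le_exp.2
        have := ht.1; have := ht.2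
        calc c * t ≤ |c| * t := by gcongr; exact le_abs_self c
          _ ≤ _ := by gcongr
    exact this
  have hmem : ∀ᵐ t ∂ν, t ∈ Set.Ioc 0 T := ae_restrict_mem measurableSet_Ioc
  have hconv : ∀ (w : ℝ → W), ∀ t ∈ Set.Ioc 0 T,
      ∫ s, N t s (Real.exp (-σ * s) • w s) ∂ν = Real.exp (-σ * t) • ∫ s, K t s (w s) ∂ν := by
    intro w t ht
    rw [← integral_smul]
    refine integral_congr_ae ?_
    filter_upwards [hmem] with s hs
    simp only [N, if_pos (And.intro ht hs), smul_apply, map_smul, smul_smul]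
    rw [← Real.exp_add]
    congr 2; ring
  have heq : ∀ (w : ℝ → W), (∀ᵐ t ∂ν, w t = h t + ∫ s, K t s (w s) ∂ν) ↔
      ∀ᵐ t ∂ν, Real.exp (-σ * t) • w t = Real.exp (-σ * t) • h t
        + ∫ s, N t s (Real.exp (-σ * s) • w s) ∂ν := by
    intro w
    refine Filter.eventually_congr ?_
    filter_upwards [hmem] with t ht
    rw [hconv w t ht, ← smul_add]
    exact (smul_right_injective W (Real.exp_pos (-σ * t)).ne').eq_iff.symm
  obtain ⟨z, hz, hze⟩ := aux_exist hNm hNL hNh (hwt (-σ) h hi)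
  have hzw : ∀ t, Real.exp (-σ * t) • (Real.exp (σ * t) • z t) = z t := by
    intro t
    rw [smul_smul, ← Real.exp_add]
    simp
  have hEq : ∀ᵐ t ∂ν, Real.exp (σ * t) • z t = h t + ∫ s, K t s (Real.exp (σ * s) • z s) ∂ν := by
    refine (heq (fun t => Real.exp (σ * t) • z t)).2 ?_
    simp only [hzw]
    exact hze
  have hwi := hwt σ z hz
  refine ⟨fun t => Real.exp (σ * t) • z t, hwi, hEq, ?_, ?_⟩
  · intro w' hw' he'
    have hd : Integrable (fun t => Real.exp (-σ * t) • w' t - z t) ν := (hwt (-σ) w' hw').sub hz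
    have := aux_bound hNm hNL hNh hd (integrable_zero ℝ W ν) (by
      filter_upwards [(heq w').1 he', hze] with t h1 h2
      have j1 := (aux_K hNm hNL hNh (hwt (-σ) w' hw')).1 t
      have j2 := (aux_K hNm hNL hNh hz).1 t
      simp only [map_sub]
      rw [integral_sub j1 j2, h1]
      nth_rewrite 1 [h2]
      simp)
    simp only [Pi.zero_apply, norm_zero, integral_zero, mul_zero] at this
    have h0 := (integral_eq_zero_iff_of_nonneg (fun t => norm_nonneg _) hd.norm).1
      (le_antisymm this (integral_nonneg fun t => norm_nonneg _))
    filter_upwards [h0] with t ht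
    have h1 : Real.exp (-σ * t) • w' t = z t := sub_eq_zero.1 (norm_eq_zero.1 ht)
    rw [← h1, smul_smul, ← Real.exp_add]
    simp
  · have hb := aux_bound hNm hNL hNh hz (hwt (-σ) h hi) hze
    have hb1 : ∫ t, ‖Real.exp (-σ * t) • h t‖ ∂ν ≤ ∫ t, ‖h t‖ ∂ν := by
      refine integral_mono_ae (hwt (-σ) h hi).norm hi.norm ?_
      filter_upwards [hmem] with t ht
      rw [norm_smul, Real.norm_of_nonneg (Real.exp_pos _).le]
      refine mul_le_of_le_one_left (norm_nonneg _) ?_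
      rw [Real.exp_le_one_iff]
      have : 0 ≤ σ * t := mul_nonneg (by positivity) ht.1.le
      linarith
    calc ∫ t, ‖Real.exp (σ * t) • z t‖ ∂ν ≤ ∫ t, Real.exp (σ * T) * ‖z t‖ ∂ν := by
          refine integral_mono_ae hwi.norm (hz.norm.const_mul _) ?_
          filter_upwards [hmem] with t ht
          rw [norm_smul, Real.norm_of_nonneg (Real.exp_pos _).le]
          have : 0 < σ := by positivity
          have := ht.2
          gcongr
      _ = Real.exp (σ * T) * ∫ t, ‖z t‖ ∂ν := integral_const_mul _ _
      _ ≤ Real.exp (σ * T) * (2 * ∫ t, ‖h t‖ ∂ν) := by gcongr; linarith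
      _ = _ := by ring

end Volt

theorem aux_lin {E : Type} [NormedAddCommGroup E] [NormedSpace ℝ E] (A B : E) (x y c d m n : ℝ)
    (hx : |x| ≤ c) (hy : |y| ≤ d) (hA : ‖A‖ ≤ m) (hB : ‖B‖ ≤ n) :
    ‖x • A + y • B‖ ≤ c * m + d * n := by
  refine (norm_add_le _ _).trans ?_
  rw [norm_smul, norm_smul, Real.norm_eq_abs, Real.norm_eq_abs]
  have := (abs_nonneg x).trans hx
  have := (abs_nonneg y).trans hy
  gcongr

theorem aux_int {E : Type} [NormedAddCommGroup E] [NormedSpace ℝ E] {ν : Measure ℝ}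
    {F G : ℝ → E} {x y : ℝ → ℝ} {c d : ℝ} (hF : Integrable F ν) (hG : Integrable G ν)
    (hx : Measurable x) (hy : Measurable y) (hxc : ∀ s, |x s| ≤ c) (hyd : ∀ s, |y s| ≤ d) :
    Integrable (fun s => x s • F s + y s • G s) ν := by
  have i1 : Integrable (fun s => x s • F s) ν :=
    Integrable.bdd_smul (C := c) hF hx.aestronglyMeasurable (ae_of_all _ hxc)
  have i2 : Integrable (fun s => y s • G s) ν :=
    Integrable.bdd_smul (C := d) hG hy.aestronglyMeasurable (ae_of_all _ hyd)
  exact i1.add i2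

/-- truncated kernel -/
theorem aux_kernel (T C : ℝ) (hC : 0 ≤ C) (k : ℝ → ℝ → ℝ) (hk : Measurable (Function.uncurry k))
    (hb : ∀ᵐ ts : ℝ × ℝ ∂volume, 0 ≤ ts.2 → ts.2 ≤ ts.1 → ts.1 ≤ T → |k ts.1 ts.2| ≤ C) :
    ∃ κ : ℝ → ℝ → ℝ, Measurable (Function.uncurry κ) ∧ (∀ t s, |κ t s| ≤ C) ∧
      (∀ t s, t < s → κ t s = 0) ∧
      ∀ᵐ t, t ≤ T → ∀ᵐ s, 0 < s → s ≤ t → κ t s = k t s := by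
  refine ⟨fun t s => if s ≤ t ∧ |k t s| ≤ C then k t s else 0, ?_, ?_, ?_, ?_⟩
  · have : Measurable (fun x : ℝ × ℝ =>
        if x.2 ≤ x.1 ∧ |Function.uncurry k x| ≤ C then Function.uncurry k x else 0) := by
      refine Measurable.ite ?_ hk measurable_const
      exact (measurableSet_le measurable_snd measurable_fst).inter
        (measurableSet_le (measurable_norm.comp hk) measurable_const)
    exact this
  · intro t s
    dsimp only
    split_ifs with h
    · exact h.2
    · simpa using hC
  · intro t s h
    dsimp only
    rw [if_neg (fun hh => not_lt.2 hh.1 h)]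
  · have h1 := Measure.ae_ae_of_ae_prod (μ := (volume : Measure ℝ)) (ν := (volume : Measure ℝ)) hb
    filter_upwards [h1] with t ht htT
    filter_upwards [ht] with s hs h0 hst
    exact if_pos ⟨hst, hs h0.le hst htT⟩

/-- Under the λ-setup with `Im B = Q'` (inf-sup with constant
`β > 0` on all of `Q`) and `Λ > 0` there are constants `C₁, C₂, C₃, C₄ > 0`,
depending only on `α₀, β, ‖a‖, ‖b‖, C_{k₁}, C_{k₂}, T, Λ` and in particular
independent of `λ ∈ (0,Λ]`, such that Problem (P_λ) has exactly one solution
(up to a.e. equality on `J`) and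
`‖u‖_{L¹(J;V)} ≤ C₁‖f‖_{L¹(J;V')} + C₂‖g‖_{L¹(J;Q')}`,
`‖p‖_{L¹(J;Q)} ≤ C₃‖f‖_{L¹(J;V')} + C₄‖g‖_{L¹(J;Q')}`. -/
theorem statement8
    (α₀ β Na Nb Ck1 Ck2 T Lam : ℝ)
    (hα₀ : 0 < α₀) (hβ : 0 < β) (hT : 0 < T) (hLam : 0 < Lam)
    (hNa : 0 ≤ Na) (hNb : 0 ≤ Nb) (hCk1 : 0 ≤ Ck1) (hCk2 : 0 ≤ Ck2) :
    ∃ C₁ C₂ C₃ C₄ : ℝ, 0 < C₁ ∧ 0 < C₂ ∧ 0 < C₃ ∧ 0 < C₄ ∧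
      ∀ (V Q : Type)
        [NormedAddCommGroup V] [InnerProductSpace ℝ V] [CompleteSpace V]
        [NormedAddCommGroup Q] [InnerProductSpace ℝ Q] [CompleteSpace Q]
        (a : V →L[ℝ] V →L[ℝ] ℝ) (b : V →L[ℝ] Q →L[ℝ] ℝ)
        (k₁ k₂ : ℝ → ℝ → ℝ),
        (∀ v w : V, a v w = a w v) → (∀ v : V, 0 ≤ a v v) →
        ‖a‖ ≤ Na → ‖b‖ ≤ Nb →
        (∀ v ∈ LinearMap.ker b.toLinearMap, α₀ * ‖v‖ ^ 2 ≤ a v v) →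
        (∀ q : Q, β * ‖q‖ ≤ ‖b.flip q‖) →
        Measurable (Function.uncurry k₁) → Measurable (Function.uncurry k₂) →
        (∀ᵐ ts : ℝ × ℝ ∂volume,
          0 ≤ ts.2 → ts.2 ≤ ts.1 → ts.1 ≤ T → |k₁ ts.1 ts.2| ≤ Ck1) →
        (∀ᵐ ts : ℝ × ℝ ∂volume,
          0 ≤ ts.2 → ts.2 ≤ ts.1 → ts.1 ≤ T → |k₂ ts.1 ts.2| ≤ Ck2) →
        ∀ lam : ℝ, 0 < lam → lam ≤ Lam →
        ∀ (f : ℝ → V →L[ℝ] ℝ) (g : ℝ → Q →L[ℝ] ℝ),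
        IntervalIntegrable f volume 0 T → IntervalIntegrable g volume 0 T →
        ∃ (u : ℝ → V) (p : ℝ → Q),
          IntervalIntegrable u volume 0 T ∧ IntervalIntegrable p volume 0 T ∧
          SolvesPlam V Q T lam a b k₁ k₂ f g u p ∧
          (∀ (u' : ℝ → V) (p' : ℝ → Q),
            IntervalIntegrable u' volume 0 T → IntervalIntegrable p' volume 0 T →
            SolvesPlam V Q T lam a b k₁ k₂ f g u' p' →
            ∀ᵐ t ∂volume, t ∈ Set.Icc (0:ℝ) T → u' t = u t ∧ p' t = p t) ∧
          (∫ t in (0:ℝ)..T, ‖u t‖)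
            ≤ C₁ * (∫ t in (0:ℝ)..T, ‖f t‖) + C₂ * (∫ t in (0:ℝ)..T, ‖g t‖) ∧
          (∫ t in (0:ℝ)..T, ‖p t‖)
            ≤ C₃ * (∫ t in (0:ℝ)..T, ‖f t‖) + C₄ * (∫ t in (0:ℝ)..T, ‖g t‖) := by
  obtain ⟨c, hc, hst⟩ := aux_static α₀ β Na Lam hα₀ hβ hNa hLam
  set L := Ck1 * (c * Na) + Ck2 * (c * Nb) with hL
  have hL0 : 0 ≤ L := by positivity
  set C := 2 * Real.exp ((2 * L + 1) * T) * c with hC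
  have hC0 : 0 < C := by positivity
  refine ⟨C, C, C, C, hC0, hC0, hC0, hC0, ?_⟩
  intro V Q _ _ _ _ _ _ a b k₁ k₂ hs hp ha hnb hco hb hk1 hk2 hkb1 hkb2 lam hlam hlL f g hf hg
  obtain ⟨S, hSn, hS⟩ := hst V Q a b hs hp ha hco hb lam hlam hlL
  obtain ⟨κ1, m1, bd1, z1, e1⟩ := aux_kernel T Ck1 hCk1 k₁ hk1 hkb1
  obtain ⟨κ2, m2, bd2, z2, e2⟩ := aux_kernel T Ck2 hCk2 k₂ hk2 hkb2
  let S' : (V →L[ℝ] ℝ) →L[ℝ] V × Q := S.comp (ContinuousLinearMap.inl ℝ _ _)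
  have hS' : ∀ x, ‖S' x‖ ≤ c * ‖x‖ := by
    intro x
    refine (S.le_of_opNorm_le hSn (x, 0)).trans (le_of_eq ?_)
    simp
  let A1 : (V × Q) →L[ℝ] V × Q := S'.comp (a.comp (ContinuousLinearMap.fst ℝ V Q))
  let A2 : (V × Q) →L[ℝ] V × Q := S'.comp (b.flip.comp (ContinuousLinearMap.snd ℝ V Q))
  have hA1 : ‖A1‖ ≤ c * Na := by
    refine ContinuousLinearMap.opNorm_le_bound _ (by positivity) (fun x => ?_)
    calc ‖A1 x‖ ≤ c * ‖a x.1‖ := hS' _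
      _ ≤ c * (Na * ‖x‖) := by
        gcongr
        exact (a.le_of_opNorm_le ha x.1).trans (by gcongr; exact norm_fst_le x)
      _ = _ := by ring
  have hnb' : ‖b.flip‖ ≤ Nb := by rw [ContinuousLinearMap.opNorm_flip]; exact hnb
  have hA2 : ‖A2‖ ≤ c * Nb := by
    refine ContinuousLinearMap.opNorm_le_bound _ (by positivity) (fun x => ?_)
    calc ‖A2 x‖ ≤ c * ‖b.flip x.2‖ := hS' _
      _ ≤ c * (Nb * ‖x‖) := by
        gcongr
        exact (b.flip.le_of_opNorm_le hnb' x.2).trans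
          (by gcongr; exact norm_snd_le x)
      _ = _ := by ring
  let K : ℝ → ℝ → (V × Q) →L[ℝ] V × Q := fun t s => κ1 t s • A1 + κ2 t s • A2
  have hKm : StronglyMeasurable (Function.uncurry K) :=
    (m1.stronglyMeasurable.smul_const A1).add (m2.stronglyMeasurable.smul_const A2)
  have hKL : ∀ t s, ‖K t s‖ ≤ L := by
    intro t s
    exact aux_lin A1 A2 _ _ _ _ _ _ (bd1 t s) (bd2 t s) hA1 hA2
  have hK0 : ∀ t s, t < s → K t s = 0 := by
    intro t s h
    simp only [K, z1 t s h, z2 t s h, zero_smul, add_zero]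
  rw [intervalIntegrable_iff_integrableOn_Ioc_of_le hT.le] at hf hg
  have hfg : IntegrableOn (fun t => (f t, g t)) (Set.Ioc 0 T) := hf.prodMk hg
  have hSfg : IntegrableOn (fun t => S (f t, g t)) (Set.Ioc 0 T) := S.integrable_comp hfg
  -- equivalence with the Volterra equation
  have hequiv : ∀ (u : ℝ → V) (p : ℝ → Q), IntegrableOn u (Set.Ioc 0 T) →
      IntegrableOn p (Set.Ioc 0 T) → (SolvesPlam V Q T lam a b k₁ k₂ f g u p ↔
        ∀ᵐ t ∂(volume.restrict (Set.Ioc 0 T)),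
          (u t, p t) = S (f t, g t) + ∫ s in Set.Ioc 0 T, K t s (u s, p s)) := by
    intro u p hu hpi
    unfold SolvesPlam
    rw [← ae_restrict_iff' measurableSet_Icc,
      ← Measure.restrict_congr_set (Ioc_ae_eq_Icc (μ := (volume : Measure ℝ)) (a := 0) (b := T))]
    refine Filter.eventually_congr ?_
    filter_upwards [ae_restrict_mem measurableSet_Ioc, ae_restrict_of_ae e1, ae_restrict_of_ae e2]
      with t ht h1 h2
    have h1 := h1 ht.2
    have h2 := h2 ht.2
    have i12 : Integrable (fun s => κ1 t s • a (u s) + κ2 t s • b.flip (p s))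
        (volume.restrict (Set.Ioc 0 T)) :=
      aux_int (a.integrable_comp hu) (b.flip.integrable_comp hpi) (m1.comp measurable_prodMk_left)
        (m2.comp measurable_prodMk_left) (bd1 t) (bd2 t)
    set J : V →L[ℝ] ℝ := ∫ s in Set.Ioc 0 T, (κ1 t s • a (u s) + κ2 t s • b.flip (p s)) with hJ
    have hKJ : ∫ s in Set.Ioc 0 T, K t s (u s, p s) = S' J := by
      rw [hJ, ← S'.integral_comp_comm i12]
      refine integral_congr_ae (ae_of_all _ fun s => ?_)
      simp only [map_add, map_smul]
      rfl
    have hJv : ∀ v, J v = ∫ s in (0:ℝ)..t, (k₁ t s * a (u s) v + k₂ t s * b v (p s)) := by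
      intro v
      rw [hJ, ContinuousLinearMap.integral_apply i12, intervalIntegral.integral_of_le ht.1.le]
      rw [← integral_indicator measurableSet_Ioc, ← integral_indicator measurableSet_Ioc]
      refine integral_congr_ae ?_
      filter_upwards [h1, h2] with s hs1 hs2
      by_cases hst : s ≤ t
      · by_cases h0 : 0 < s
        · rw [Set.indicator_of_mem (show s ∈ Set.Ioc 0 T from ⟨h0, hst.trans ht.2⟩),
            Set.indicator_of_mem (show s ∈ Set.Ioc 0 t from ⟨h0, hst⟩), hs1 h0 hst, hs2 h0 hst]
          rfl
        · rw [Set.indicator_of_notMem (fun h => h0 h.1), Set.indicator_of_notMem (fun h => h0 h.1)]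
      · rw [Set.indicator_of_notMem (s := Set.Ioc 0 t) (fun h => hst h.2)]
        rw [not_le] at hst
        simp [Set.indicator, z1 t s hst, z2 t s hst]
    have hsum : S (f t, g t) + S' J = S (f t + J, g t) := by
      show S (f t, g t) + S (J, 0) = _
      rw [← map_add]
      simp
    rw [hKJ, hsum, ← hS (u t) (p t) (f t + J) (g t)]
    simp only [add_apply, hJv]
  obtain ⟨w, hw, hwe, hwu, hwb⟩ := aux_volterra T L hT K hKm hKL hK0 _ hSfg
  have hu : IntegrableOn (fun t => (w t).1) (Set.Ioc 0 T) := hw.fst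
  have hpp : IntegrableOn (fun t => (w t).2) (Set.Ioc 0 T) := hw.snd
  have hfin : ∫ t in Set.Ioc 0 T, ‖w t‖
      ≤ C * (∫ t in Set.Ioc 0 T, ‖f t‖) + C * (∫ t in Set.Ioc 0 T, ‖g t‖) := by
    refine hwb.trans ?_
    have : ∫ t in Set.Ioc 0 T, ‖S (f t, g t)‖ ≤ ∫ t in Set.Ioc 0 T, c * (‖f t‖ + ‖g t‖) := by
      refine integral_mono hSfg.norm ((hf.norm.add hg.norm).const_mul c) (fun t => ?_)
      refine (S.le_of_opNorm_le hSn _).trans ?_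
      gcongr
      exact max_le (le_add_of_nonneg_right (norm_nonneg _)) (le_add_of_nonneg_left (norm_nonneg _))
    rw [integral_const_mul, integral_add hf.norm hg.norm] at this
    calc _ ≤ 2 * Real.exp ((2 * L + 1) * T) *
          (c * ((∫ t in Set.Ioc 0 T, ‖f t‖) + ∫ t in Set.Ioc 0 T, ‖g t‖)) := by gcongr
      _ = _ := by rw [hC]; ring
  refine ⟨fun t => (w t).1, fun t => (w t).2, ?_, ?_, ?_, ?_, ?_, ?_⟩
  · rwa [intervalIntegrable_iff_integrableOn_Ioc_of_le hT.le]
  · rwa [intervalIntegrable_iff_integrableOn_Ioc_of_le hT.le]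
  · exact (hequiv _ _ hu hpp).2 hwe
  · intro u' p' hu' hp' hsol
    rw [intervalIntegrable_iff_integrableOn_Ioc_of_le hT.le] at hu' hp'
    have := hwu (fun t => (u' t, p' t)) (hu'.prodMk hp') ((hequiv u' p' hu' hp').1 hsol)
    rw [← ae_restrict_iff' measurableSet_Icc,
      ← Measure.restrict_congr_set (Ioc_ae_eq_Icc (μ := (volume : Measure ℝ)) (a := 0) (b := T))]
    filter_upwards [this] with t ht
    exact ⟨congrArg Prod.fst ht, congrArg Prod.snd ht⟩
  · simp only [intervalIntegral.integral_of_le hT.le]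
    exact (integral_mono hu.norm hw.norm (fun t => norm_fst_le (w t))).trans hfin
  · simp only [intervalIntegral.integral_of_le hT.le]
    exact (integral_mono hpp.norm hw.norm (fun t => norm_snd_le (w t))).trans hfin
end

section
/- Suppose (u,p) ∈ L¹(J;V) × L¹(J;Q) satisfies the first equation of Problem (P_λ): for a.e. t ∈ J and all v ∈ V, a(u(t),v) + b(v,p(t)) = ⟨f(t),v⟩ + ∫₀ᵗ [k₁(t,s) a(u(s),v) + k₂(t,s) b(v,p(s))] ds, with |k₁(t,s)| ≤ C_{k₁} a.e. on the triangle. Writing |v|_a := a(v,v)^{1/2}, u₀(t) = P_K u(t) and ū(t) = P_{K⊥} u(t), one has for a.e. t ∈ J: |u₀(t)|_a ≤ α₀^{-1/2} ‖f(t)‖_{V'} + |ū(t)|_a + C_{k₁} ∫₀ᵗ |u(s)|_a ds. -/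
open MeasureTheory

/-- If `(u,p)` satisfies the first equation of Problem (P_λ) with
bounded kernel `k₁`, then with `|v|_a := a(v,v)^{1/2}` and the orthogonal
decomposition `u = u₀ + ū` along `K = ker B` and `K⊥`, for a.e. `t ∈ J`:
`|u₀(t)|_a ≤ α₀^{-1/2}‖f(t)‖_{V'} + |ū(t)|_a + C_{k₁} ∫₀ᵗ |u(s)|_a ds`. -/
theorem statement10
    {V Q : Type*} [NormedAddCommGroup V] [InnerProductSpace ℝ V] [CompleteSpace V]
    [NormedAddCommGroup Q] [InnerProductSpace ℝ Q] [CompleteSpace Q]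
    (T : ℝ) (hT : 0 < T)
    (a : V →L[ℝ] V →L[ℝ] ℝ) (b : V →L[ℝ] Q →L[ℝ] ℝ)
    (ha_symm : ∀ v w : V, a v w = a w v) (ha_pos : ∀ v : V, 0 ≤ a v v)
    (α₀ : ℝ) (hα₀ : 0 < α₀)
    (hcoer : ∀ v ∈ LinearMap.ker (b : V →ₗ[ℝ] Q →L[ℝ] ℝ), α₀ * ‖v‖ ^ 2 ≤ a v v)
    (k₁ k₂ : ℝ → ℝ → ℝ) (Ck₁ : ℝ) (hCk₁ : 0 ≤ Ck₁)
    (hk₁_meas : Measurable (Function.uncurry k₁))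
    (hk₂_meas : Measurable (Function.uncurry k₂))
    (hk₁_bdd : ∀ᵐ ts : ℝ × ℝ ∂volume,
      0 ≤ ts.2 → ts.2 ≤ ts.1 → ts.1 ≤ T → |k₁ ts.1 ts.2| ≤ Ck₁)
    (u : ℝ → V) (p : ℝ → Q) (f : ℝ → V →L[ℝ] ℝ)
    (hu : IntervalIntegrable u volume 0 T) (hp : IntervalIntegrable p volume 0 T)
    (hf : IntervalIntegrable f volume 0 T)
    (u₀ ubar : ℝ → V)
    (hdec : ∀ t : ℝ, u₀ t ∈ LinearMap.ker (b : V →ₗ[ℝ] Q →L[ℝ] ℝ) ∧ ubar t ∈ (LinearMap.ker (b : V →ₗ[ℝ] Q →L[ℝ] ℝ))ᗮ ∧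
      u t = u₀ t + ubar t)
    (heq : ∀ᵐ t ∂volume, t ∈ Set.Icc (0:ℝ) T → ∀ v : V,
      a (u t) v + b v (p t)
        = f t v + ∫ s in (0:ℝ)..t, (k₁ t s * a (u s) v + k₂ t s * b v (p s))) :
    ∀ᵐ t ∂volume, t ∈ Set.Icc (0:ℝ) T →
      Real.sqrt (a (u₀ t) (u₀ t))
        ≤ (Real.sqrt α₀)⁻¹ * ‖f t‖ + Real.sqrt (a (ubar t) (ubar t))
          + Ck₁ * ∫ s in (0:ℝ)..t, Real.sqrt (a (u s) (u s)) := by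
  have hCS : ∀ v w : V, |a v w| ≤ Real.sqrt (a v v) * Real.sqrt (a w w) := by
    intro v w
    have h : a v w ^ 2 ≤ a v v * a w w := by
      have hq : ∀ x : ℝ, 0 ≤ a w w * (x * x) + (2 * a v w) * x + a v v := by
        intro x
        have := ha_pos (v + x • w)
        simp only [map_add, map_smul, _root_.add_apply,
          _root_.smul_apply, smul_eq_mul, ha_symm w v] at this
        nlinarith [this]
      have := discrim_le_zero hq
      unfold discrim at this
      nlinarith [this]
    rw [← Real.sqrt_mul (ha_pos v)]
    exact Real.abs_le_sqrt h
  have hk := Measure.ae_ae_of_ae_prod (μ := (volume : Measure ℝ)) (ν := (volume : Measure ℝ)) hk₁_bdd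
  filter_upwards [heq, hk] with t ht hkt htI
  obtain ⟨h0, -, hsum⟩ := hdec t
  have hb : b (u₀ t) = 0 := by simpa using h0
  have e := ht htI (u₀ t)
  simp only [hb, _root_.zero_apply, mul_zero, add_zero] at e
  rw [hsum] at e
  simp only [map_add, _root_.add_apply] at e
  have hut : IntervalIntegrable u volume 0 t := by
    apply hu.mono_set
    rw [Set.uIcc_of_le htI.1, Set.uIcc_of_le hT.le]
    exact Set.Icc_subset_Icc le_rfl htI.2
  have hint : IntervalIntegrable (fun s => Real.sqrt (a (u s) (u s))) volume 0 t := by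
    rw [intervalIntegrable_iff] at hut ⊢
    have hm := hut.aestronglyMeasurable
    have hc : Continuous (fun v : V => Real.sqrt (a v v)) := by fun_prop
    refine Integrable.mono' (hut.norm.const_mul (Real.sqrt ‖a‖))
      (hc.comp_aestronglyMeasurable hm) (Filter.Eventually.of_forall fun s => ?_)
    rw [Real.norm_of_nonneg (Real.sqrt_nonneg _)]
    have h1 : a (u s) (u s) ≤ ‖a‖ * ‖u s‖ ^ 2 := by
      have := (le_abs_self _).trans (a.le_opNorm₂ (u s) (u s))
      nlinarith [this]
    calc Real.sqrt (a (u s) (u s)) ≤ Real.sqrt (‖a‖ * ‖u s‖ ^ 2) := Real.sqrt_le_sqrt h1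
      _ = Real.sqrt ‖a‖ * ‖u s‖ := by
        rw [Real.sqrt_mul (norm_nonneg a), Real.sqrt_sq (norm_nonneg _)]
  set I := ∫ s in (0:ℝ)..t, Real.sqrt (a (u s) (u s)) with hI
  have hI0 : 0 ≤ I := intervalIntegral.integral_nonneg htI.1 fun s _ => Real.sqrt_nonneg _
  have hbound : ‖∫ s in (0:ℝ)..t, k₁ t s * a (u s) (u₀ t)‖
      ≤ Ck₁ * I * Real.sqrt (a (u₀ t) (u₀ t)) := by
    have : Ck₁ * I * Real.sqrt (a (u₀ t) (u₀ t)) =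
        ∫ s in (0:ℝ)..t, Ck₁ * Real.sqrt (a (u s) (u s)) * Real.sqrt (a (u₀ t) (u₀ t)) := by
      rw [intervalIntegral.integral_mul_const, intervalIntegral.integral_const_mul]
    rw [this]
    refine intervalIntegral.norm_integral_le_of_norm_le htI.1 ?_
      ((hint.const_mul _).mul_const _)
    filter_upwards [hkt] with s hs hsI
    rw [norm_mul, Real.norm_eq_abs, Real.norm_eq_abs, mul_assoc]
    exact mul_le_mul (hs hsI.1.le hsI.2 htI.2) (hCS _ _) (abs_nonneg _) hCk₁
  rw [Real.norm_eq_abs] at hbound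
  have hfb : f t (u₀ t) ≤ (Real.sqrt α₀)⁻¹ * ‖f t‖ * Real.sqrt (a (u₀ t) (u₀ t)) := by
    have hn : ‖u₀ t‖ ≤ (Real.sqrt α₀)⁻¹ * Real.sqrt (a (u₀ t) (u₀ t)) := by
      rw [le_inv_mul_iff₀ (Real.sqrt_pos.2 hα₀)]
      calc _ = Real.sqrt (α₀ * ‖u₀ t‖ ^ 2) := by
            rw [Real.sqrt_mul hα₀.le, Real.sqrt_sq (norm_nonneg _)]
        _ ≤ _ := Real.sqrt_le_sqrt (hcoer _ h0)
    calc f t (u₀ t) ≤ ‖f t‖ * ‖u₀ t‖ := (le_abs_self _).trans ((f t).le_opNorm _)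
      _ ≤ ‖f t‖ * ((Real.sqrt α₀)⁻¹ * Real.sqrt (a (u₀ t) (u₀ t))) := by gcongr
      _ = _ := by ring
  have h2 := hCS (ubar t) (u₀ t)
  have hsq := Real.mul_self_sqrt (ha_pos (u₀ t))
  have hR : 0 ≤ (Real.sqrt α₀)⁻¹ * ‖f t‖ + Real.sqrt (a (ubar t) (ubar t)) + Ck₁ * I := by
    positivity
  rcases (Real.sqrt_nonneg (a (u₀ t) (u₀ t))).eq_or_lt with h | h
  · rw [← h]; exact hR
  · refine le_of_mul_le_mul_right ?_ h
    have := (abs_le.1 h2).1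
    have := (abs_le.1 hbound).2
    rw [hsq]
    linarith
end

section
/- Suppose (u,p) ∈ L¹(J;V) × L¹(J;Q) satisfies the first equation of Problem (P_λ) (for a.e. t ∈ J and all v ∈ V, a(u(t),v) + b(v,p(t)) = ⟨f(t),v⟩ + ∫₀ᵗ [k₁(t,s) a(u(s),v) + k₂(t,s) b(v,p(s))] ds, with |k₁(t,s)| ≤ C_{k₁} a.e. on the triangle), and assume ‖Bv‖_{Q'} ≥ β‖v‖_V for all v ∈ K⊥ with β > 0. Then with u₀(t) = P_K u(t), for every t ∈ J: ∫₀ᵗ ‖u₀(s)‖_V ds ≤ M₁ ∫₀ᵗ ‖f(s)‖_{V'} ds + M₂ ∫₀ᵗ ‖B u(s)‖_{Q'} ds, where, setting E := 1 + (T C_{k₁} ‖a‖^{1/2}/α₀^{1/2}) exp(T C_{k₁} ‖a‖^{1/2}/α₀^{1/2}), one has M₁ = E/α₀ and M₂ = (‖a‖^{1/2}/(β α₀^{1/2})) E (1 + T C_{k₁}). -/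
open MeasureTheory

theorem gron_aux {H : ℝ → ℝ} {t C G : ℝ} (ht : 0 ≤ t) (hC : 0 ≤ C)
    (hH : ContinuousOn H (Set.Icc 0 t))
    (hb : ∀ s ∈ Set.Icc (0:ℝ) t, H s ≤ G + C * ∫ r in (0:ℝ)..s, H r) :
    H t ≤ G * Real.exp (C * t) := by
  have hI : IntervalIntegrable H volume 0 t := by
    apply ContinuousOn.intervalIntegrable
    rwa [Set.uIcc_of_le ht]
  have hcont : ContinuousOn (fun s => ∫ r in (0:ℝ)..s, H r) (Set.Icc 0 t) := by
    have := intervalIntegral.continuousOn_primitive_interval' hI Set.left_mem_uIcc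
    rwa [Set.uIcc_of_le ht] at this
  have hder : ∀ x ∈ Set.Ioo (0:ℝ) t, HasDerivAt (fun s => ∫ r in (0:ℝ)..s, H r) (H x) x := by
    intro x hx
    apply intervalIntegral.integral_hasDerivAt_right
    · apply hI.mono_set
      rw [Set.uIcc_of_le ht, Set.uIcc_of_le hx.1.le]
      exact Set.Icc_subset_Icc_right hx.2.le
    · exact ContinuousOn.stronglyMeasurableAtFilter isOpen_Ioo
        (hH.mono Set.Ioo_subset_Icc_self) x hx
    · exact hH.continuousAt (Icc_mem_nhds hx.1 hx.2)
  have hder2 : ∀ x ∈ Set.Ioo (0:ℝ) t,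
      HasDerivAt (fun s => (G + C * ∫ r in (0:ℝ)..s, H r) * Real.exp (-(C * s)))
        ((C * H x) * Real.exp (-(C * x)) +
          (G + C * ∫ r in (0:ℝ)..x, H r) * (Real.exp (-(C * x)) * (-(C * 1)))) x := by
    intro x hx
    exact (((hder x hx).const_mul C).const_add G).mul
      (((hasDerivAt_id x).const_mul C).neg.exp)
  have hanti : AntitoneOn (fun s => (G + C * ∫ r in (0:ℝ)..s, H r) * Real.exp (-(C * s)))
      (Set.Icc 0 t) := by
    apply antitoneOn_of_deriv_nonpos (convex_Icc 0 t)
    · exact (continuousOn_const.add (continuousOn_const.mul hcont)).mul (by fun_prop)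
    · rw [interior_Icc]
      exact fun x hx => (hder2 x hx).differentiableAt.differentiableWithinAt
    · rw [interior_Icc]
      intro x hx
      rw [(hder2 x hx).deriv]
      have h1 := hb x (Set.Ioo_subset_Icc_self hx)
      have h2 := mul_nonneg (mul_nonneg hC (Real.exp_pos (-(C * x))).le) (sub_nonneg.2 h1)
      nlinarith
  have h0 := hanti (Set.left_mem_Icc.2 ht) (Set.right_mem_Icc.2 ht) ht
  simp only [intervalIntegral.integral_same, mul_zero, add_zero, neg_zero, Real.exp_zero,
    mul_one] at h0
  have h1 := hb t (Set.right_mem_Icc.2 ht)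
  have h2 : G + C * ∫ r in (0:ℝ)..t, H r ≤ G * Real.exp (C * t) := by
    have := mul_le_mul_of_nonneg_right h0 (Real.exp_pos (C * t)).le
    rwa [mul_assoc, ← Real.exp_add, neg_add_cancel, Real.exp_zero, mul_one] at this
  exact h1.trans h2

theorem cs_aux {V : Type*} [NormedAddCommGroup V] [InnerProductSpace ℝ V]
    (a : V →L[ℝ] V →L[ℝ] ℝ)
    (ha_symm : ∀ v w : V, a v w = a w v) (ha_pos : ∀ v : V, 0 ≤ a v v) (v w : V) :
    |a v w| ≤ Real.sqrt (a v v) * Real.sqrt (a w w) := by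
  rw [← Real.sqrt_mul (ha_pos v)]
  apply Real.abs_le_sqrt
  have h := fun x : ℝ => ha_pos (x • v + w)
  have h' : ∀ x : ℝ, 0 ≤ a v v * (x * x) + (2 * a v w) * x + a w w := by
    intro x
    have := h x
    simp only [map_add, map_smul, add_apply, smul_apply, smul_eq_mul] at this
    rw [ha_symm w v] at this
    nlinarith
  have := discrim_le_zero h'
  unfold discrim at this
  nlinarith

theorem sq_aux {V : Type*} [NormedAddCommGroup V] [InnerProductSpace ℝ V]
    (a : V →L[ℝ] V →L[ℝ] ℝ) (v : V) :
    Real.sqrt (a v v) ≤ Real.sqrt ‖a‖ * ‖v‖ := by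
  have h : a v v ≤ ‖a‖ * ‖v‖ ^ 2 := by
    have := (le_abs_self _).trans (a.le_opNorm₂ v v)
    nlinarith
  calc Real.sqrt (a v v) ≤ Real.sqrt (‖a‖ * ‖v‖ ^ 2) := Real.sqrt_le_sqrt h
    _ = _ := by rw [Real.sqrt_mul (norm_nonneg a), Real.sqrt_sq (norm_nonneg v)]

/-- If `(u,p)` satisfies the first equation of Problem (P_λ) with
bounded kernel `k₁`, and `‖Bv‖_{Q'} ≥ β‖v‖_V` for all `v ∈ K⊥`, then with
`u₀(t) = P_K u(t)`, for every `t ∈ J`: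
`∫₀ᵗ ‖u₀(s)‖ ds ≤ M₁ ∫₀ᵗ ‖f(s)‖ ds + M₂ ∫₀ᵗ ‖B u(s)‖ ds`, where
`E = 1 + (T C_{k₁} ‖a‖^{1/2}/α₀^{1/2}) exp(T C_{k₁} ‖a‖^{1/2}/α₀^{1/2})`,
`M₁ = E/α₀` and `M₂ = (‖a‖^{1/2}/(β α₀^{1/2})) E (1 + T C_{k₁})`. -/
theorem statement11
    {V Q : Type*} [NormedAddCommGroup V] [InnerProductSpace ℝ V] [CompleteSpace V]
    [NormedAddCommGroup Q] [InnerProductSpace ℝ Q] [CompleteSpace Q]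
    (T : ℝ) (hT : 0 < T)
    (a : V →L[ℝ] V →L[ℝ] ℝ) (b : V →L[ℝ] Q →L[ℝ] ℝ)
    (ha_symm : ∀ v w : V, a v w = a w v) (ha_pos : ∀ v : V, 0 ≤ a v v)
    (α₀ : ℝ) (hα₀ : 0 < α₀)
    (hcoer : ∀ v ∈ LinearMap.ker (b : V →ₗ[ℝ] Q →L[ℝ] ℝ), α₀ * ‖v‖ ^ 2 ≤ a v v)
    (β : ℝ) (hβ : 0 < β)
    (hinfsupV : ∀ v ∈ (LinearMap.ker (b : V →ₗ[ℝ] Q →L[ℝ] ℝ))ᗮ, β * ‖v‖ ≤ ‖b v‖)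
    (k₁ k₂ : ℝ → ℝ → ℝ) (Ck₁ : ℝ) (hCk₁ : 0 ≤ Ck₁)
    (hk₁_meas : Measurable (Function.uncurry k₁))
    (hk₂_meas : Measurable (Function.uncurry k₂))
    (hk₁_bdd : ∀ᵐ ts : ℝ × ℝ ∂volume,
      0 ≤ ts.2 → ts.2 ≤ ts.1 → ts.1 ≤ T → |k₁ ts.1 ts.2| ≤ Ck₁)
    (u : ℝ → V) (p : ℝ → Q) (f : ℝ → V →L[ℝ] ℝ)
    (hu : IntervalIntegrable u volume 0 T) (hp : IntervalIntegrable p volume 0 T)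
    (hf : IntervalIntegrable f volume 0 T)
    (u₀ : ℝ → V)
    (hdec : ∀ t : ℝ, u₀ t ∈ LinearMap.ker (b : V →ₗ[ℝ] Q →L[ℝ] ℝ) ∧ u t - u₀ t ∈ (LinearMap.ker (b : V →ₗ[ℝ] Q →L[ℝ] ℝ))ᗮ)
    (heq : ∀ᵐ t ∂volume, t ∈ Set.Icc (0:ℝ) T → ∀ v : V,
      a (u t) v + b v (p t)
        = f t v + ∫ s in (0:ℝ)..t, (k₁ t s * a (u s) v + k₂ t s * b v (p s))) :
    ∀ E M₁ M₂ : ℝ,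
      E = 1 + (T * Ck₁ * Real.sqrt ‖a‖ / Real.sqrt α₀) *
            Real.exp (T * Ck₁ * Real.sqrt ‖a‖ / Real.sqrt α₀) →
      M₁ = E / α₀ →
      M₂ = (Real.sqrt ‖a‖ / (β * Real.sqrt α₀)) * E * (1 + T * Ck₁) →
      ∀ t ∈ Set.Icc (0:ℝ) T,
        (∫ s in (0:ℝ)..t, ‖u₀ s‖)
          ≤ M₁ * (∫ s in (0:ℝ)..t, ‖f s‖) + M₂ * ∫ s in (0:ℝ)..t, ‖b (u s)‖ := by
  intro E M₁ M₂ hE hM₁ hM₂ t ht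
  obtain ⟨ht0, htT⟩ := ht
  set K := LinearMap.ker (b : V →ₗ[ℝ] Q →L[ℝ] ℝ) with hK
  have hKb : ∀ v ∈ K, b v = 0 := fun v hv => by simpa [hK] using hv
  have hKc : IsClosed (K : Set V) := by
    have : (K : Set V) = b ⁻¹' {0} := by ext v; simp [hK]
    rw [this]
    exact isClosed_singleton.preimage b.continuous
  have : CompleteSpace K := hKc.completeSpace_coe
  have hu0 : u₀ = fun t => K.starProjection (u t) := by
    funext s
    exact (Submodule.eq_starProjection_of_mem_orthogonal (hdec s).1 (hdec s).2).symm
  have hsub : Set.uIcc 0 t ⊆ Set.uIcc 0 T := by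
    rw [Set.uIcc_of_le ht0, Set.uIcc_of_le hT.le]; exact Set.Icc_subset_Icc_right htT
  have hu' := hu.mono_set hsub
  have hf' := hf.mono_set hsub
  have hu0i : IntervalIntegrable u₀ volume 0 t := by
    rw [hu0]; exact ⟨K.starProjection.integrable_comp hu'.1, K.starProjection.integrable_comp hu'.2⟩
  have hbui : IntervalIntegrable (fun s => ‖b (u s)‖) volume 0 t :=
    (show IntervalIntegrable (fun s => b (u s)) volume 0 t from
      ⟨b.integrable_comp hu'.1, b.integrable_comp hu'.2⟩).norm
  have hfi := hf'.norm
  have hF0 : 0 ≤ ∫ s in (0:ℝ)..t, ‖f s‖ :=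
    intervalIntegral.integral_nonneg ht0 fun _ _ => norm_nonneg _
  have hN0 : 0 ≤ ∫ s in (0:ℝ)..t, ‖b (u s)‖ :=
    intervalIntegral.integral_nonneg ht0 fun _ _ => norm_nonneg _
  set F := ∫ s in (0:ℝ)..t, ‖f s‖ with hF
  set N := ∫ s in (0:ℝ)..t, ‖b (u s)‖ with hN
  have hsα : 0 < Real.sqrt α₀ := Real.sqrt_pos.2 hα₀
  have hsa : 0 ≤ Real.sqrt ‖a‖ := Real.sqrt_nonneg _
  have hx0 : 0 ≤ T * Ck₁ * Real.sqrt ‖a‖ / Real.sqrt α₀ := by positivity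
  have hE1 : 1 ≤ E := by
    rw [hE]; have := mul_nonneg hx0 (Real.exp_pos (T * Ck₁ * Real.sqrt ‖a‖ / Real.sqrt α₀)).le
    linarith
  have hE0 : 0 ≤ E := zero_le_one.trans hE1
  by_cases hKt : ∀ v ∈ K, v = 0
  · have : ∀ s, u₀ s = 0 := fun s => hKt _ (hdec s).1
    simp only [this, norm_zero, intervalIntegral.integral_zero]
    have h1 : 0 ≤ M₁ := by rw [hM₁]; positivity
    have h2 : 0 ≤ M₂ := by rw [hM₂]; positivity
    positivity
  push Not at hKt
  obtain ⟨v₀, hv₀K, hv₀⟩ := hKt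
  have hαa : α₀ ≤ ‖a‖ := by
    have h1 := hcoer v₀ hv₀K
    have h2 := (le_abs_self _).trans (a.le_opNorm₂ v₀ v₀)
    have h3 : 0 < ‖v₀‖ := norm_pos_iff.2 hv₀
    have h4 : 0 < ‖v₀‖ ^ 2 := by positivity
    apply le_of_mul_le_mul_right _ h4
    nlinarith
  have hexpE : Real.exp (Ck₁ * t) ≤ E := by
    set x := T * Ck₁ * Real.sqrt ‖a‖ / Real.sqrt α₀ with hx
    have h1 : Ck₁ * t ≤ x := by
      rw [hx, le_div_iff₀ hsα]
      have := Real.sqrt_le_sqrt hαa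
      calc Ck₁ * t * Real.sqrt α₀ ≤ Ck₁ * T * Real.sqrt ‖a‖ := by gcongr
        _ = _ := by ring
    have h2 : Real.exp x ≤ E := by
      rw [hE]
      have h3 := Real.add_one_le_exp (-x)
      have h4 := mul_le_mul_of_nonneg_right h3 (Real.exp_pos x).le
      rw [← Real.exp_add, neg_add_cancel, Real.exp_zero] at h4
      linarith
    exact (Real.exp_le_exp.2 h1).trans h2
  -- the energy seminorm
  set A : V → ℝ := fun v => Real.sqrt (a v v) with hA
  have hA0 : ∀ v, 0 ≤ A v := fun v => Real.sqrt_nonneg _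
  have hAsq : ∀ v, A v * A v = a v v := fun v => Real.mul_self_sqrt (ha_pos v)
  have hCS : ∀ v w, |a v w| ≤ A v * A w := cs_aux a ha_symm ha_pos
  have hAn : ∀ v, A v ≤ Real.sqrt ‖a‖ * ‖v‖ := sq_aux a
  have hAK : ∀ v ∈ K, Real.sqrt α₀ * ‖v‖ ≤ A v := by
    intro v hv
    have := Real.sqrt_le_sqrt (hcoer v hv)
    rwa [Real.sqrt_mul hα₀.le, Real.sqrt_sq (norm_nonneg _)] at this
  have hAc : Continuous A := by
    apply Real.continuous_sqrt.comp
    exact a.continuous.clm_apply continuous_id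
  have hφi : IntervalIntegrable (fun s => A (u₀ s)) volume 0 t := by
    refine (hu0i.norm.const_mul (Real.sqrt ‖a‖)).mono_fun ?_ ?_
    · exact hAc.comp_aestronglyMeasurable (intervalIntegrable_iff.1 hu0i).aestronglyMeasurable
    · refine Filter.Eventually.of_forall fun s => ?_
      beta_reduce
      rw [Real.norm_of_nonneg (hA0 _), Real.norm_of_nonneg (by positivity)]
      exact hAn _
  set c := Real.sqrt ‖a‖ / β with hc
  have hc0 : 0 ≤ c := by positivity
  have hw : ∀ s, A (u s - u₀ s) ≤ c * ‖b (u s)‖ := by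
    intro s
    have h1 := hinfsupV _ (hdec s).2
    rw [map_sub, hKb _ (hdec s).1, sub_zero] at h1
    calc A (u s - u₀ s) ≤ Real.sqrt ‖a‖ * ‖u s - u₀ s‖ := hAn _
      _ ≤ Real.sqrt ‖a‖ * (‖b (u s)‖ / β) := by
        gcongr
        rw [le_div_iff₀ hβ]; linarith
      _ = _ := by rw [hc]; ring
  have hk : ∀ᵐ r : ℝ, ∀ᵐ s : ℝ, 0 ≤ s → s ≤ r → r ≤ T → |k₁ r s| ≤ Ck₁ :=
    Measure.ae_ae_of_ae_prod hk₁_bdd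
  set H : ℝ → ℝ := fun r => ∫ s in (0:ℝ)..r, A (u₀ s) with hH
  have mono : ∀ {g : ℝ → ℝ} {r : ℝ}, IntervalIntegrable g volume 0 t → 0 ≤ r → r ≤ t →
      IntervalIntegrable g volume 0 r := by
    intro g r hg h0 h1
    apply hg.mono_set
    rw [Set.uIcc_of_le ht0, Set.uIcc_of_le h0]; exact Set.Icc_subset_Icc_right h1
  have hpt : ∀ᵐ r : ℝ, r ∈ Set.Icc 0 t →
      A (u₀ r) ≤ (Real.sqrt α₀)⁻¹ * ‖f r‖ + c * ‖b (u r)‖ + Ck₁ * c * N + Ck₁ * H r := by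
    filter_upwards [hk, heq] with r hkr hr hrt
    have h0 := hr ⟨hrt.1, hrt.2.trans htT⟩ (u₀ r)
    have hK0 := hKb _ (hdec r).1
    simp only [hK0, zero_apply, mul_zero, add_zero] at h0
    have hH0 : 0 ≤ H r := intervalIntegral.integral_nonneg hrt.1 fun _ _ => hA0 _
    have hbr := mono hbui hrt.1 hrt.2
    have hφr := mono hφi hrt.1 hrt.2
    have hNr : ∫ s in (0:ℝ)..r, ‖b (u s)‖ ≤ N := by
      apply intervalIntegral.integral_mono_interval le_rfl hrt.1 hrt.2 _ hbui
      exact Filter.Eventually.of_forall fun _ => norm_nonneg _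
    have hint : ‖∫ s in (0:ℝ)..r, k₁ r s * a (u s) (u₀ r)‖
        ≤ ∫ s in (0:ℝ)..r, Ck₁ * A (u₀ r) * (A (u₀ s) + c * ‖b (u s)‖) := by
      apply intervalIntegral.norm_integral_le_of_norm_le hrt.1
      · filter_upwards [hkr] with s hs hsr
        have h1 := hs hsr.1.le hsr.2 (hrt.2.trans htT)
        have h2 : |a (u s) (u₀ r)| ≤ (A (u₀ s) + c * ‖b (u s)‖) * A (u₀ r) := by
          have e : a (u s) (u₀ r) = a (u₀ s) (u₀ r) + a (u s - u₀ s) (u₀ r) := by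
            simp
          rw [e]
          have h3 := hCS (u₀ s) (u₀ r)
          have h4 := (hCS (u s - u₀ s) (u₀ r)).trans
            (mul_le_mul_of_nonneg_right (hw s) (hA0 _))
          have := abs_add_le (a (u₀ s) (u₀ r)) (a (u s - u₀ s) (u₀ r))
          linarith
        rw [Real.norm_eq_abs, abs_mul]
        calc _ ≤ Ck₁ * ((A (u₀ s) + c * ‖b (u s)‖) * A (u₀ r)) := by gcongr
          _ = _ := by ring
      · exact (hφr.add (hbr.const_mul c)).const_mul _
    rw [intervalIntegral.integral_const_mul, intervalIntegral.integral_add hφr (hbr.const_mul c),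
      intervalIntegral.integral_const_mul] at hint
    have hint2 : ∫ s in (0:ℝ)..r, k₁ r s * a (u s) (u₀ r) ≤
        Ck₁ * A (u₀ r) * (H r + c * N) := by
      refine (le_abs_self _).trans (hint.trans ?_)
      have := hA0 (u₀ r)
      gcongr
    have hfr : f r (u₀ r) ≤ (Real.sqrt α₀)⁻¹ * ‖f r‖ * A (u₀ r) := by
      have h1 := (le_abs_self _).trans ((f r).le_opNorm (u₀ r))
      have h2 := hAK _ (hdec r).1
      calc _ ≤ ‖f r‖ * ‖u₀ r‖ := h1
        _ = (Real.sqrt α₀)⁻¹ * ‖f r‖ * (Real.sqrt α₀ * ‖u₀ r‖) := by field_simp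
        _ ≤ _ := by gcongr
    have hwr : -(a (u r - u₀ r) (u₀ r)) ≤ c * ‖b (u r)‖ * A (u₀ r) :=
      (neg_le_abs _).trans ((hCS _ _).trans (mul_le_mul_of_nonneg_right (hw r) (hA0 _)))
    have e : a (u r) (u₀ r) = A (u₀ r) * A (u₀ r) + a (u r - u₀ r) (u₀ r) := by
      rw [hAsq]; simp
    rcases (hA0 (u₀ r)).eq_or_lt with hz | hz
    · rw [← hz]; positivity
    · apply le_of_mul_le_mul_right _ hz
      nlinarith
  have hHc : ContinuousOn H (Set.Icc 0 t) := by
    have := intervalIntegral.continuousOn_primitive_interval' hφi Set.left_mem_uIcc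
    rwa [Set.uIcc_of_le ht0] at this
  have hHi : IntervalIntegrable H volume 0 t := by
    apply ContinuousOn.intervalIntegrable
    rwa [Set.uIcc_of_le ht0]
  set G := (Real.sqrt α₀)⁻¹ * F + c * N + T * (Ck₁ * c * N) with hG
  have hG0 : 0 ≤ G := by positivity
  have hHG : ∀ s ∈ Set.Icc (0:ℝ) t, H s ≤ G + Ck₁ * ∫ r in (0:ℝ)..s, H r := by
    intro s hs
    have i1 := (mono hfi hs.1 hs.2).const_mul (Real.sqrt α₀)⁻¹
    have i2 := (mono hbui hs.1 hs.2).const_mul c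
    have i3 : IntervalIntegrable (fun _ : ℝ => Ck₁ * c * N) volume 0 s := by simp
    have i4 := (mono hHi hs.1 hs.2).const_mul Ck₁
    have h1 : H s ≤ ∫ r in (0:ℝ)..s,
        ((Real.sqrt α₀)⁻¹ * ‖f r‖ + c * ‖b (u r)‖ + Ck₁ * c * N + Ck₁ * H r) := by
      apply intervalIntegral.integral_mono_ae_restrict hs.1 (mono hφi hs.1 hs.2)
        (((i1.add i2).add i3).add i4)
      refine (ae_restrict_iff' measurableSet_Icc).2 ?_
      filter_upwards [hpt] with r hr hrs
      exact hr ⟨hrs.1, hrs.2.trans hs.2⟩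
    rw [intervalIntegral.integral_add ((i1.add i2).add i3) i4,
      intervalIntegral.integral_add (i1.add i2) i3, intervalIntegral.integral_add i1 i2] at h1
    simp only [intervalIntegral.integral_const_mul, intervalIntegral.integral_const,
      sub_zero, smul_eq_mul] at h1
    have hNr : ∫ s in (0:ℝ)..s, ‖b (u s)‖ ≤ N := by
      apply intervalIntegral.integral_mono_interval le_rfl hs.1 hs.2 _ hbui
      exact Filter.Eventually.of_forall fun _ => norm_nonneg _
    have hFr : ∫ s in (0:ℝ)..s, ‖f s‖ ≤ F := by
      apply intervalIntegral.integral_mono_interval le_rfl hs.1 hs.2 _ hfi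
      exact Filter.Eventually.of_forall fun _ => norm_nonneg _
    have q1 := mul_le_mul_of_nonneg_left hNr hc0
    have q2 := mul_le_mul_of_nonneg_left hFr (inv_nonneg.2 hsα.le)
    have q3 := mul_le_mul_of_nonneg_right (hs.2.trans htT)
      (show 0 ≤ Ck₁ * c * N by positivity)
    linarith
  have hfin := gron_aux ht0 hCk₁ hHc hHG
  have hfin2 : H t ≤ G * E := hfin.trans (mul_le_mul_of_nonneg_left hexpE hG0)
  have hlow : Real.sqrt α₀ * ∫ s in (0:ℝ)..t, ‖u₀ s‖ ≤ H t := by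
    rw [← intervalIntegral.integral_const_mul]
    exact intervalIntegral.integral_mono_on ht0 (hu0i.norm.const_mul _) hφi
      fun s _ => hAK _ (hdec s).1
  have hres : M₁ * F + M₂ * N = (G * E) / Real.sqrt α₀ := by
    rw [hM₁, hM₂, hG, hc]
    have : α₀ = Real.sqrt α₀ * Real.sqrt α₀ := (Real.mul_self_sqrt hα₀.le).symm
    rw [show E / α₀ = E / (Real.sqrt α₀ * Real.sqrt α₀) by rw [← this]]
    field_simp
    ring
  rw [hres, le_div_iff₀ hsα]
  linarith
end

section
/- Under the λ-setup with surjectivity (‖B*q‖_{V'} ≥ β‖q‖_Q for all q ∈ Q, β > 0), suppose (u,p) solves Problem (P_λ) with g = 0. Then ‖p‖_{L¹(J;Q)} ≤ C₃ ‖f‖_{L¹(J;V')}, where the explicit constant is C₃ = (1/β) [ (1 + (‖a‖/α₀)^{1/2}) + 2 T C_{k₁} M₁ ‖a‖ ] (1 + T N e^{T N}), with E := 1 + (T C_{k₁} ‖a‖^{1/2}/α₀^{1/2}) exp(T C_{k₁} ‖a‖^{1/2}/α₀^{1/2}), M₁ = E/α₀, M₂ = (‖a‖^{1/2}/(β α₀^{1/2}))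 E (1 + T C_{k₁}), and N = 2λ C_{k₁} M₂ ‖a‖/β + 2λ C_{k₁} ‖a‖/β² + C_{k₂}. -/
open MeasureTheory
open scoped RealInnerProductSpace


theorem aux_lift
    {V Q : Type*} [NormedAddCommGroup V] [InnerProductSpace ℝ V] [CompleteSpace V]
    [NormedAddCommGroup Q] [InnerProductSpace ℝ Q] [CompleteSpace Q]
    (b : V →L[ℝ] Q →L[ℝ] ℝ)
    (β : ℝ) (hβ : 0 < β)
    (hsurj : ∀ q : Q, β * ‖q‖ ≤ ‖b.flip q‖) (q : Q) :
    ∃ v : V, (∀ r, b v r = ⟪q, r⟫) ∧ ‖v‖ ≤ ‖q‖ / β := by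
  let Bs : Q →L[ℝ] V :=
    LinearMap.mkContinuous
      { toFun := fun r => (InnerProductSpace.toDual ℝ V).symm (b.flip r)
        map_add' := fun x y => by rw [map_add, map_add]
        map_smul' := fun m x => by rw [map_smul, map_smulₛₗ]; simp }
      ‖b.flip‖ (fun r => by simpa using b.flip.le_opNorm r)
  have hBs : ∀ r v, ⟪Bs r, v⟫ = b v r := by
    intro r v
    simp [Bs]
  have hBn : ∀ r, ‖Bs r‖ = ‖b.flip r‖ := by
    intro r
    simp [Bs]
  let c : Q →L[ℝ] Q →L[ℝ] ℝ := (innerSL ℝ).bilinearComp Bs Bs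
  have hc : ∀ r s, c r s = ⟪Bs r, Bs s⟫ := by intro r s; simp [c]
  have hcc : IsCoercive c := by
    refine ⟨β ^ 2, by positivity, fun r => ?_⟩
    rw [hc, real_inner_self_eq_norm_sq, hBn]
    have h1 := hsurj r
    have h2 : 0 ≤ β * ‖r‖ := by positivity
    nlinarith
  let q' := hcc.continuousLinearEquivOfBilin.symm q
  have hq : ∀ r, ⟪Bs q', Bs r⟫ = ⟪q, r⟫ := by
    intro r
    rw [← hc, ← hcc.continuousLinearEquivOfBilin_apply]
    simp [q']
  refine ⟨Bs q', fun r => ?_, ?_⟩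
  · rw [← hBs, real_inner_comm, hq]
  · have h1 := hq q'
    rw [real_inner_self_eq_norm_sq] at h1
    have h2 := real_inner_le_norm q q'
    have h3 := hsurj q'
    rw [← hBn] at h3
    rw [le_div_iff₀ hβ]
    by_contra hcon
    push Not at hcon
    have h5 : 0 < ‖Bs q'‖ := by
      by_contra h0
      have : ‖Bs q'‖ = 0 := le_antisymm (not_lt.1 h0) (norm_nonneg _)
      rw [this] at hcon
      nlinarith [norm_nonneg q]
    have h6 : β * ‖Bs q'‖^2 ≤ ‖q‖ * ‖Bs q'‖ := by
      calc β * ‖Bs q'‖^2 ≤ β * (‖q‖ * ‖q'‖) := by gcongr; linarith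
        _ = ‖q‖ * (β * ‖q'‖) := by ring
        _ ≤ _ := by gcongr
    nlinarith

theorem aux_proj
    {V : Type*} [NormedAddCommGroup V] [InnerProductSpace ℝ V] [CompleteSpace V]
    (a : V →L[ℝ] V →L[ℝ] ℝ)
    (ha_symm : ∀ v w : V, a v w = a w v) (ha_pos : ∀ v : V, 0 ≤ a v v)
    (α₀ : ℝ) (hα₀ : 0 < α₀) (K : Submodule ℝ V) (hK : IsClosed (K : Set V))
    (hcoer : ∀ v ∈ K, α₀ * ‖v‖ ^ 2 ≤ a v v) (v : V) :
    ∃ k ∈ K, (∀ m ∈ K, a (v - k) m = 0) ∧ ‖k‖ ≤ Real.sqrt (‖a‖ / α₀) * ‖v‖ ∧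
      a (v - k) (v - k) ≤ ‖a‖ * ‖v‖ ^ 2 := by
  have : CompleteSpace K := hK.completeSpace_coe
  let c : K →L[ℝ] K →L[ℝ] ℝ := a.bilinearComp K.subtypeL K.subtypeL
  have hc : ∀ r s : K, c r s = a r s := by intro r s; simp [c]
  have hcc : IsCoercive c := by
    refine ⟨α₀, hα₀, fun r => ?_⟩
    rw [hc]
    have := hcoer r r.2
    simp only [Submodule.coe_norm] at *
    nlinarith
  let k := hcc.continuousLinearEquivOfBilin.symm
    ((InnerProductSpace.toDual ℝ K).symm ((a v).comp K.subtypeL))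
  have hk : ∀ m : K, a k m = a v m := by
    intro m
    rw [← hc, ← hcc.continuousLinearEquivOfBilin_apply]
    simp [k]
  have horth : ∀ m ∈ K, a (v - k) m = 0 := by
    intro m hm
    have := hk ⟨m, hm⟩
    simp only [map_sub, _root_.sub_apply]
    simp only at this
    linarith
  have hv : a v v ≤ ‖a‖ * ‖v‖ ^ 2 := by
    have := a.le_opNorm₂ v v
    have h2 := le_abs_self (a v v)
    rw [Real.norm_eq_abs] at this
    nlinarith
  have hdec : a v v = a (v - k) (v - k) + a k k := by
    have h1 := hk k
    have h2 := ha_symm v k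
    simp only [map_sub, _root_.sub_apply]
    linarith
  refine ⟨k, k.2, horth, ?_, ?_⟩
  · have h1 := hcoer k k.2
    have h2 := ha_pos (v - k)
    have h3 : ‖(k:V)‖ ^ 2 ≤ (‖a‖ / α₀) * ‖v‖ ^ 2 := by
      rw [div_mul_eq_mul_div, le_div_iff₀ hα₀]
      linarith
    have h4 : 0 ≤ ‖a‖ / α₀ := by positivity
    apply le_of_sq_le_sq _ (by positivity)
    rw [mul_pow, Real.sq_sqrt h4]
    exact h3
  · have := ha_pos k
    linarith

theorem aux_gron (T : ℝ) (hT : 0 < T) (y F : ℝ → ℝ) (n : ℝ) (hn : 0 ≤ n)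
    (hF0 : ∀ t, 0 ≤ F t)
    (hy : IntervalIntegrable y volume 0 T) (hF : IntervalIntegrable F volume 0 T)
    (h : ∀ᵐ t ∂volume, t ∈ Set.Icc (0:ℝ) T → y t ≤ F t + n * ∫ s in (0:ℝ)..t, y s) :
    ∫ t in (0:ℝ)..T, y t ≤ (∫ t in (0:ℝ)..T, F t) * Real.exp (n * T) := by
  set Y : ℝ → ℝ := fun t => ∫ s in (0:ℝ)..t, y s with hY
  have hYc : ContinuousOn Y (Set.Icc 0 T) := by
    have := intervalIntegral.continuousOn_primitive_interval' hy Set.left_mem_uIcc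
    rwa [Set.uIcc_of_le hT.le] at this
  have hYi : IntervalIntegrable Y volume 0 T := by
    apply ContinuousOn.intervalIntegrable
    rwa [Set.uIcc_of_le hT.le]
  set δ := ∫ t in (0:ℝ)..T, F t with hδ
  have hδ0 : 0 ≤ δ := intervalIntegral.integral_nonneg hT.le fun t _ => hF0 t
  let Z : ℝ → ℝ := fun t => δ + n * ∫ s in (0:ℝ)..t, Y s
  have sub : ∀ t ∈ Set.Icc 0 T, Set.uIcc 0 t ⊆ Set.uIcc 0 T := by
    intro t ht
    rw [Set.uIcc_of_le hT.le, Set.uIcc_of_le ht.1]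
    exact Set.Icc_subset_Icc le_rfl ht.2
  have hYZ : ∀ t ∈ Set.Icc 0 T, Y t ≤ Z t := by
    intro t ht
    have hyt := hy.mono_set (sub t ht)
    have hFt := hF.mono_set (sub t ht)
    have hYt := hYi.mono_set (sub t ht)
    have h1 : Y t ≤ ∫ s in (0:ℝ)..t, (F s + n * Y s) := by
      apply intervalIntegral.integral_mono_ae_restrict ht.1 hyt (hFt.add (hYt.const_mul n))
      rw [Filter.EventuallyLE, ae_restrict_iff' measurableSet_Icc]
      filter_upwards [h] with s hs hs2
      exact hs ⟨hs2.1, hs2.2.trans ht.2⟩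
    rw [intervalIntegral.integral_add hFt (hYt.const_mul n), intervalIntegral.integral_const_mul] at h1
    have h2 : ∫ s in (0:ℝ)..t, F s ≤ δ := by
      apply intervalIntegral.integral_mono_interval le_rfl ht.1 ht.2 _ hF
      exact Filter.Eventually.of_forall hF0
    simp only [Z]
    linarith
  have hZc : ContinuousOn Z (Set.Icc 0 T) := by
    have := intervalIntegral.continuousOn_primitive_interval' hYi Set.left_mem_uIcc
    rw [Set.uIcc_of_le hT.le] at this
    exact continuousOn_const.add (continuousOn_const.mul this)
  have hZd : ∀ t ∈ Set.Ico 0 T, HasDerivWithinAt Z (n * Y t) (Set.Ici t) t := by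
    intro t ht
    have htt : t ∈ Set.Icc 0 T := ⟨ht.1, ht.2.le⟩
    have : HasDerivWithinAt (fun r => ∫ s in (0:ℝ)..r, Y s) (Y t) (Set.Ici t) t := by
      apply intervalIntegral.integral_hasDerivWithinAt_right (hYi.mono_set (sub t htt)) (t := Set.Ioi t)
      · refine ⟨Set.Icc 0 T, ?_, (hYc.aestronglyMeasurable measurableSet_Icc)⟩
        exact Filter.mem_of_superset (Ioc_mem_nhdsGT ht.2) fun x hx => ⟨ht.1.trans hx.1.le, hx.2⟩
      · have h1 := hYc t htt
        apply h1.mono_of_mem_nhdsWithin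
        exact Filter.mem_of_superset (Ioc_mem_nhdsGT ht.2) fun x hx => ⟨ht.1.trans hx.1.le, hx.2⟩
    exact (this.const_mul n).const_add δ
  have key := le_gronwallBound_of_liminf_deriv_right_le (f := Z) (f' := fun t => n * Y t) (δ := δ) (K := n) (ε := 0) (a := 0) (b := T)
    hZc (fun x hx r hr => (hZd x hx).liminf_right_slope_le hr) (by simp [Z])
    (fun x hx => by
      have := hYZ x ⟨hx.1, hx.2.le⟩
      have := mul_le_mul_of_nonneg_left this hn
      simpa using this) T ⟨hT.le, le_rfl⟩
  rw [gronwallBound_ε0, sub_zero] at key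
  exact (hYZ T ⟨hT.le, le_rfl⟩).trans key

set_option maxHeartbeats 2000000 in
/-- Under the λ-setup with surjectivity (`‖B*q‖ ≥ β‖q‖` for all
`q ∈ Q`), if `(u,p)` solves Problem (P_λ) with `g = 0`, then
`‖p‖_{L¹(J;Q)} ≤ C₃ ‖f‖_{L¹(J;V')}` with the explicit constant
`C₃ = (1/β)[(1 + (‖a‖/α₀)^{1/2}) + 2 T C_{k₁} M₁ ‖a‖](1 + T N e^{T N})`. -/
theorem statement12
    {V Q : Type*} [NormedAddCommGroup V] [InnerProductSpace ℝ V] [CompleteSpace V]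
    [NormedAddCommGroup Q] [InnerProductSpace ℝ Q] [CompleteSpace Q]
    (T : ℝ) (hT : 0 < T)
    (a : V →L[ℝ] V →L[ℝ] ℝ) (b : V →L[ℝ] Q →L[ℝ] ℝ)
    (ha_symm : ∀ v w : V, a v w = a w v) (ha_pos : ∀ v : V, 0 ≤ a v v)
    (α₀ : ℝ) (hα₀ : 0 < α₀)
    (hcoer : ∀ v ∈ LinearMap.ker (b : V →ₗ[ℝ] Q →L[ℝ] ℝ), α₀ * ‖v‖ ^ 2 ≤ a v v)
    (β : ℝ) (hβ : 0 < β)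
    (hsurj : ∀ q : Q, β * ‖q‖ ≤ ‖b.flip q‖)
    (k₁ k₂ : ℝ → ℝ → ℝ) (Ck₁ Ck₂ : ℝ) (hCk₁ : 0 ≤ Ck₁) (hCk₂ : 0 ≤ Ck₂)
    (hk₁_meas : Measurable (Function.uncurry k₁))
    (hk₂_meas : Measurable (Function.uncurry k₂))
    (hk₁_bdd : ∀ᵐ ts : ℝ × ℝ ∂volume,
      0 ≤ ts.2 → ts.2 ≤ ts.1 → ts.1 ≤ T → |k₁ ts.1 ts.2| ≤ Ck₁)
    (hk₂_bdd : ∀ᵐ ts : ℝ × ℝ ∂volume,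
      0 ≤ ts.2 → ts.2 ≤ ts.1 → ts.1 ≤ T → |k₂ ts.1 ts.2| ≤ Ck₂)
    (lam : ℝ) (hlam : 0 < lam)
    (u : ℝ → V) (p : ℝ → Q) (f : ℝ → V →L[ℝ] ℝ)
    (hu : IntervalIntegrable u volume 0 T) (hp : IntervalIntegrable p volume 0 T)
    (hf : IntervalIntegrable f volume 0 T)
    (heq1 : ∀ᵐ t ∂volume, t ∈ Set.Icc (0:ℝ) T → ∀ v : V,
      a (u t) v + b v (p t)
        = f t v + ∫ s in (0:ℝ)..t, (k₁ t s * a (u s) v + k₂ t s * b v (p s)))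
    (heq2 : ∀ᵐ t ∂volume, t ∈ Set.Icc (0:ℝ) T → ∀ q : Q,
      b (u t) q - lam * ⟪p t, q⟫ = 0) :
    ∀ E M₁ M₂ N C₃ : ℝ,
      E = 1 + (T * Ck₁ * Real.sqrt ‖a‖ / Real.sqrt α₀) *
            Real.exp (T * Ck₁ * Real.sqrt ‖a‖ / Real.sqrt α₀) →
      M₁ = E / α₀ →
      M₂ = (Real.sqrt ‖a‖ / (β * Real.sqrt α₀)) * E * (1 + T * Ck₁) →
      N = 2 * lam * Ck₁ * M₂ * ‖a‖ / β + 2 * lam * Ck₁ * ‖a‖ / β ^ 2 + Ck₂ →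
      C₃ = (1 / β) * ((1 + Real.sqrt (‖a‖ / α₀)) + 2 * T * Ck₁ * M₁ * ‖a‖) *
            (1 + T * N * Real.exp (T * N)) →
      (∫ t in (0:ℝ)..T, ‖p t‖) ≤ C₃ * ∫ t in (0:ℝ)..T, ‖f t‖ := by
  intro E M₁ M₂ N C₃ hE hM₁ hM₂ hN hC₃
  have hKc : IsClosed ((LinearMap.ker (b : V →ₗ[ℝ] Q →L[ℝ] ℝ) : Submodule ℝ V) : Set V) :=
    ContinuousLinearMap.isClosed_ker b
  set κ := Real.sqrt (‖a‖ / α₀) with hκ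
  have hκ0 : 0 ≤ κ := Real.sqrt_nonneg _
  have hlift : ∀ q : Q, ∃ w : V, (∀ r, b w r = ⟪q, r⟫) ∧ (∀ m, b m = 0 → a w m = 0) ∧
      ‖w‖ ≤ (1 + κ) / β * ‖q‖ ∧ a w w ≤ ‖a‖ / β ^ 2 * ‖q‖ ^ 2 := by
    intro q
    obtain ⟨v, hv, hvn⟩ := aux_lift b β hβ hsurj q
    obtain ⟨k, hk, hko, hkn, hka⟩ := aux_proj a ha_symm ha_pos α₀ hα₀ _ hKc hcoer v
    have hbk : b k = 0 := by simpa using hk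
    refine ⟨v - k, fun r => ?_, fun m hm => hko m (by simpa using hm), ?_, ?_⟩
    · rw [map_sub, hbk, sub_zero, hv]
    · calc ‖v - k‖ ≤ ‖v‖ + ‖k‖ := norm_sub_le _ _
        _ ≤ ‖v‖ + κ * ‖v‖ := by gcongr
        _ = (1 + κ) * ‖v‖ := by ring
        _ ≤ (1 + κ) * (‖q‖ / β) := by gcongr
        _ = _ := by ring
    · calc _ ≤ ‖a‖ * ‖v‖ ^ 2 := hka
        _ ≤ ‖a‖ * (‖q‖ / β) ^ 2 := by gcongr
        _ = _ := by field_simp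
  have hCS : ∀ v w : V, a v w ^ 2 ≤ a v v * a w w := by
    intro v w
    have h0 : ∀ x : ℝ, 0 ≤ a w w * (x * x) + (2 * a v w) * x + a v v := by
      intro x
      have h1 := ha_pos (v + x • w)
      have h2 := ha_symm v w
      simp only [map_add, map_smul, _root_.add_apply, _root_.smul_apply, smul_eq_mul] at h1
      rw [← h2] at h1
      linarith
    have := discrim_le_zero h0
    rw [discrim] at this
    linarith
  -- bound on a(u(s), w)
  have hauw : ∀ (us : V) (ps q : Q) (w : V), (∀ r, b us r - lam * ⟪ps, r⟫ = 0) →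
      (∀ m, b m = 0 → a w m = 0) → a w w ≤ ‖a‖ / β ^ 2 * ‖q‖ ^ 2 →
      |a us w| ≤ lam * (‖a‖ / β ^ 2) * ‖ps‖ * ‖q‖ := by
    intro us ps q w hus hw hww
    obtain ⟨z, hz, -, -, hzz⟩ := hlift ps
    have h1 : b (us - lam • z) = 0 := by
      ext r
      have := hus r
      simp only [map_sub, map_smul, _root_.sub_apply, _root_.smul_apply, smul_eq_mul, hz]
      simpa using this
    have h2 := hw _ h1
    rw [map_sub, map_smul, smul_eq_mul, ha_symm w us, ha_symm w z] at h2
    have h3 : a us w = lam * a z w := by linarith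
    rw [h3]
    apply abs_le_of_sq_le_sq _ (by positivity)
    have h4 := hCS z w
    have h5 : a z z * a w w ≤ (‖a‖ / β ^ 2 * ‖ps‖ ^ 2) * (‖a‖ / β ^ 2 * ‖q‖ ^ 2) :=
      mul_le_mul hzz hww (ha_pos w) (by positivity)
    calc (lam * a z w) ^ 2 = lam ^ 2 * (a z w) ^ 2 := by ring
      _ ≤ lam ^ 2 * ((‖a‖ / β ^ 2 * ‖ps‖ ^ 2) * (‖a‖ / β ^ 2 * ‖q‖ ^ 2)) := by
        gcongr
        exact h4.trans h5
      _ = _ := by ring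
  set n := Ck₁ * (lam * (‖a‖ / β ^ 2)) + Ck₂ with hn
  have hn0 : 0 ≤ n := by positivity
  have hk₁' := Measure.ae_ae_of_ae_prod hk₁_bdd
  have hk₂' := Measure.ae_ae_of_ae_prod hk₂_bdd
  have hmain : ∀ᵐ t ∂volume, t ∈ Set.Icc (0:ℝ) T →
      ‖p t‖ ≤ (1 + κ) / β * ‖f t‖ + n * ∫ s in (0:ℝ)..t, ‖p s‖ := by
    filter_upwards [hk₁', hk₂', heq1, heq2] with t h1 h2 h3 h4 ht
    obtain ⟨w, hw, hwK, hwn, hww⟩ := hlift (p t)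
    have e1 := h3 ht w
    have hpt : IntervalIntegrable (fun s => ‖p s‖) volume 0 t := by
      apply hp.norm.mono_set
      rw [Set.uIcc_of_le hT.le, Set.uIcc_of_le ht.1]
      exact Set.Icc_subset_Icc le_rfl ht.2
    have hI : ‖∫ s in (0:ℝ)..t, (k₁ t s * a (u s) w + k₂ t s * b w (p s))‖
        ≤ ∫ s in (0:ℝ)..t, (n * ‖p t‖) * ‖p s‖ := by
      apply intervalIntegral.norm_integral_le_of_norm_le ht.1 _ (hpt.const_mul _)
      filter_upwards [h1, h2, heq2] with s g1 g2 g3 hs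
      have g1 := g1 hs.1.le hs.2 ht.2
      have g2 := g2 hs.1.le hs.2 ht.2
      have g4 := hauw (u s) (p s) (p t) w (g3 ⟨hs.1.le, hs.2.trans ht.2⟩) hwK hww
      have g5 : |b w (p s)| ≤ ‖p t‖ * ‖p s‖ := by
        rw [hw]; exact abs_real_inner_le_norm _ _
      rw [Real.norm_eq_abs]
      calc _ ≤ |k₁ t s * a (u s) w| + |k₂ t s * b w (p s)| := abs_add_le _ _
        _ = |k₁ t s| * |a (u s) w| + |k₂ t s| * |b w (p s)| := by rw [abs_mul, abs_mul]
        _ ≤ Ck₁ * (lam * (‖a‖ / β ^ 2) * ‖p s‖ * ‖p t‖) + Ck₂ * (‖p t‖ * ‖p s‖) := by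
          gcongr
        _ = _ := by rw [hn]; ring
    rw [intervalIntegral.integral_const_mul] at hI
    have e2 : 0 ≤ a (u t) w := by
      have hb : b (u t - lam • w) = 0 := by
        ext r
        have := h4 ht r
        simp only [map_sub, map_smul, _root_.sub_apply, _root_.smul_apply, smul_eq_mul, hw]
        simpa using this
      have h5 := hwK _ hb
      rw [map_sub, map_smul, smul_eq_mul, ha_symm w (u t)] at h5
      have := mul_nonneg hlam.le (ha_pos w)
      linarith
    have e3 : b w (p t) = ‖p t‖ ^ 2 := by rw [hw, real_inner_self_eq_norm_sq]
    have e4 : f t w ≤ ‖f t‖ * ((1 + κ) / β * ‖p t‖) :=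
      (le_abs_self _).trans (((f t).le_opNorm w).trans (by gcongr))
    have e5 := (le_abs_self _).trans hI
    set S := ∫ s in (0:ℝ)..t, ‖p s‖ with hS
    have hS0 : 0 ≤ S := intervalIntegral.integral_nonneg ht.1 fun _ _ => norm_nonneg _
    have e6 : ‖p t‖ ^ 2 ≤ ((1 + κ) / β * ‖f t‖ + n * S) * ‖p t‖ := by nlinarith
    rcases (norm_nonneg (p t)).eq_or_lt with h0 | h0
    · rw [← h0]; positivity
    · rw [sq] at e6
      exact le_of_mul_le_mul_right e6 h0
  have hG := aux_gron T hT (fun t => ‖p t‖) (fun t => (1 + κ) / β * ‖f t‖) n hn0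
    (fun t => by positivity) hp.norm (hf.norm.const_mul _) hmain
  rw [intervalIntegral.integral_const_mul] at hG
  set Φ := ∫ t in (0:ℝ)..T, ‖f t‖ with hΦ
  have hΦ0 : 0 ≤ Φ := intervalIntegral.integral_nonneg hT.le fun _ _ => norm_nonneg _
  have hE0 : 0 ≤ E := by rw [hE]; positivity
  have hM₁0 : 0 ≤ M₁ := by rw [hM₁]; positivity
  have hM₂0 : 0 ≤ M₂ := by rw [hM₂]; positivity
  have hnN : n ≤ N := by
    rw [hn, hN]
    have x1 : 0 ≤ 2 * lam * Ck₁ * M₂ * ‖a‖ / β := by positivity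
    have x2 : 0 ≤ lam * Ck₁ * ‖a‖ / β ^ 2 := by positivity
    have x3 : Ck₁ * (lam * (‖a‖ / β ^ 2)) = lam * Ck₁ * ‖a‖ / β ^ 2 := by ring
    have x4 : 2 * lam * Ck₁ * ‖a‖ / β ^ 2 = 2 * (lam * Ck₁ * ‖a‖ / β ^ 2) := by ring
    rw [x3, x4]
    linarith
  have hN0 : 0 ≤ N := hn0.trans hnN
  have hexp : Real.exp (n * T) ≤ 1 + T * N * Real.exp (T * N) := by
    have y1 : Real.exp (n * T) ≤ Real.exp (T * N) := by
      apply Real.exp_le_exp.2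
      nlinarith
    have y2 := Real.add_one_le_exp (-(T * N))
    have y3 : Real.exp (-(T * N)) * Real.exp (T * N) = 1 := by
      rw [← Real.exp_add]; simp
    have y4 := mul_le_mul_of_nonneg_right y2 (Real.exp_pos (T * N)).le
    rw [y3] at y4
    linarith
  calc _ ≤ (1 + κ) / β * Φ * Real.exp (n * T) := hG
    _ ≤ (1 / β * ((1 + κ) + 2 * T * Ck₁ * M₁ * ‖a‖)) * Φ *
        (1 + T * N * Real.exp (T * N)) := by
      have z : (1 + κ) / β ≤ 1 / β * ((1 + κ) + 2 * T * Ck₁ * M₁ * ‖a‖) := by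
        rw [div_eq_mul_one_div, mul_comm]
        have : 0 ≤ 2 * T * Ck₁ * M₁ * ‖a‖ := by positivity
        exact mul_le_mul_of_nonneg_left (by linarith) (by positivity)
      gcongr
    _ = C₃ * Φ := by rw [hC₃]; ring
end

section
/- Under the λ-setup, assume the range of B is closed in Q' and the inf-sup condition with constant β > 0 holds on the orthogonal complements (‖B*q‖_{V'} ≥ β‖q‖_Q for all q ∈ H⊥ and ‖Bv‖_{Q'} ≥ β‖v‖_V for all v ∈ K⊥), and let Λ > 0. Then for every λ ∈ (0,Λ], f ∈ L¹(J;V') and g ∈ L¹(J;Q'), Problem (P_λ) has exactly one solution (u,p); writing p = p₀ + p̄ and g₀(t) = g(t)∘P_H, there exists a constant C > 0 depending only on α₀, β, ‖a‖, ‖b‖, C_{k₁}, C_{k₂}, T and Λ — independent of λ — such that ‖u‖_{L¹(J;V)} + ‖p̄‖_{L¹(J;Q)} ≤ C (‖f‖_{L¹(J;V')} + ‖g‖_{L¹(J;Q')}), and moreover ‖p₀‖_{L¹(J;Q)} ≤ λ^{-1} ‖g₀‖_{L¹(J;Q')}. -/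
open MeasureTheory
open scoped RealInnerProductSpace

lemma st_num (β α₀ n Na L : ℝ) (hβ : 0 < β) (hα : 0 < α₀) (hn : 0 ≤ n) (hNa : 0 ≤ Na) (hL : 0 ≤ L) :
    ∃ C : ℝ, 0 < C ∧ ∀ x y z e D : ℝ, 0 ≤ x → 0 ≤ y → 0 ≤ z → 0 ≤ e → 0 ≤ D →
      β * z ≤ D + n * e → β * y ≤ D + L * z → α₀ * x ≤ D + Na * y → e ^ 2 ≤ D * (x + y + z) →
      x + y + z ≤ C * D := by
  obtain ⟨c1, h1⟩ : ∃ c1, c1 = (1 + n) / β := ⟨_, rfl⟩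
  obtain ⟨c2, h2⟩ : ∃ c2, c2 = (1 + L * c1) / β := ⟨_, rfl⟩
  obtain ⟨c3, h3⟩ : ∃ c3, c3 = (1 + Na * c2) / α₀ := ⟨_, rfl⟩
  have p1 : 0 < c1 := by rw [h1]; positivity
  have p2 : 0 < c2 := by rw [h2]; positivity
  have p3 : 0 < c3 := by rw [h3]; positivity
  have e1 : β * c1 = 1 + n := by rw [h1]; field_simp
  have e2 : β * c2 = 1 + L * c1 := by rw [h2]; field_simp
  have e3 : α₀ * c3 = 1 + Na * c2 := by rw [h3]; field_simp
  obtain ⟨c, hc⟩ : ∃ c, c = c1 + c2 + c3 := ⟨_, rfl⟩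
  have pc : 0 < c := by rw [hc]; positivity
  refine ⟨c * (2 + c), by positivity, ?_⟩
  intro x y z e D hx hy hz he hD i1 i2 i3 i4
  have j1 : z ≤ c1 * (D + e) := by
    refine le_of_mul_le_mul_left ?_ hβ
    rw [← mul_assoc, e1]
    nlinarith [mul_nonneg hn hD]
  have j2 : y ≤ c2 * (D + e) := by
    refine le_of_mul_le_mul_left ?_ hβ
    rw [← mul_assoc, e2]
    nlinarith [mul_le_mul_of_nonneg_left j1 hL]
  have j3 : x ≤ c3 * (D + e) := by
    refine le_of_mul_le_mul_left ?_ hα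
    rw [← mul_assoc, e3]
    nlinarith [mul_le_mul_of_nonneg_left j2 hNa]
  have j4 : x + y + z ≤ c * (D + e) := by rw [hc]; linarith
  have j5 : e ^ 2 ≤ D * (c * (D + e)) := i4.trans (mul_le_mul_of_nonneg_left j4 hD)
  have j6 : e ≤ (1 + c) * D := by
    refine abs_le_of_sq_le_sq' ?_ (by positivity) |>.2
    nlinarith [sq_nonneg (c * D - e), mul_nonneg pc.le (sq_nonneg D), sq_nonneg D]
  calc x + y + z ≤ c * (D + e) := j4
    _ ≤ c * (D + (1 + c) * D) := by gcongr
    _ = _ := by ring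

lemma st_cs {V : Type} [NormedAddCommGroup V] [InnerProductSpace ℝ V]
    (a : V →L[ℝ] V →L[ℝ] ℝ) (hs : ∀ v w : V, a v w = a w v) (hp : ∀ v : V, 0 ≤ a v v) (x y : V) :
    (a x y) ^ 2 ≤ a x x * a y y := by
  have := LinearMap.BilinForm.apply_mul_apply_le_of_forall_zero_le (LinearMap.mk₂ ℝ (fun x y => a x y)
    (by simp) (by simp) (by simp) (by simp)) (by simpa using hp) x y
  simp only [LinearMap.mk₂_apply] at this
  rw [sq]; nth_rewrite 2 [hs x y]; exact this


lemma st_apply_le {V W : Type} [NormedAddCommGroup V] [NormedSpace ℝ V] [NormedAddCommGroup W] [NormedSpace ℝ W]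
    (a : V →L[ℝ] W →L[ℝ] ℝ) {N : ℝ} (h : ‖a‖ ≤ N) (v : V) (w : W) : |a v w| ≤ N * ‖v‖ * ‖w‖ := by
  have := a.le_opNorm₂ v w
  rw [Real.norm_eq_abs] at this
  exact this.trans (by gcongr)

lemma st_abs {V : Type} [NormedAddCommGroup V] [NormedSpace ℝ V]
    (F : V →L[ℝ] ℝ) (v : V) : |F v| ≤ ‖F‖ * ‖v‖ := F.le_opNorm v

/-- Uniform static estimate. -/
lemma st_est (α₀ β Na Lam : ℝ) (hα₀ : 0 < α₀) (hβ : 0 < β) (hLam : 0 < Lam) (hNa : 0 ≤ Na) :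
    ∃ C : ℝ, 0 < C ∧
      ∀ (V Q : Type)
        [NormedAddCommGroup V] [InnerProductSpace ℝ V] [CompleteSpace V]
        [NormedAddCommGroup Q] [InnerProductSpace ℝ Q] [CompleteSpace Q]
        (a : V →L[ℝ] V →L[ℝ] ℝ) (b : V →L[ℝ] Q →L[ℝ] ℝ),
        (∀ v w : V, a v w = a w v) → (∀ v : V, 0 ≤ a v v) → ‖a‖ ≤ Na →
        (∀ v ∈ LinearMap.ker b.toLinearMap, α₀ * ‖v‖ ^ 2 ≤ a v v) →
        (∀ q ∈ (LinearMap.ker b.flip.toLinearMap)ᗮ, β * ‖q‖ ≤ ‖b.flip q‖) →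
        (∀ v ∈ (LinearMap.ker b.toLinearMap)ᗮ, β * ‖v‖ ≤ ‖b v‖) →
        ∀ lam : ℝ, 0 < lam → lam ≤ Lam →
        ∀ (F : V →L[ℝ] ℝ) (G : Q →L[ℝ] ℝ) (u : V) (p p₀ pb : Q),
          (∀ v, a u v + b v p = F v) → (∀ q, b u q - lam * ⟪p, q⟫ = G q) →
          p₀ ∈ LinearMap.ker b.flip.toLinearMap → pb ∈ (LinearMap.ker b.flip.toLinearMap)ᗮ →
          p = p₀ + pb → ‖u‖ + ‖pb‖ ≤ C * (‖F‖ + ‖G‖) := by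
  obtain ⟨C, hC, H⟩ := st_num β α₀ (√Na) Na Lam hβ hα₀ (Real.sqrt_nonneg _) hNa hLam.le
  refine ⟨C, hC, ?_⟩
  intro V Q _ _ _ _ _ _ a b hs hp hN hco hB1 hB2 lam hlam hlam2 F G u p p₀ pb e1 e2 m0 mb hpp
  have hb0 : ∀ v, b v p₀ = 0 := fun v => by
    have : b.flip p₀ = 0 := m0
    simpa using congrArg (fun l => l v) this
  have hbp : ∀ v, b v p = b v pb := fun v => by rw [hpp, map_add, hb0, zero_add]
  obtain ⟨u0, hu0, ub, hub, hu⟩ :=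
    (LinearMap.ker b.toLinearMap).exists_add_mem_mem_orthogonal u
  have hbu0 : b u0 = 0 := hu0
  have hbu : b u = b ub := by rw [hu, map_add, hbu0, zero_add]
  have hE : 0 ≤ a u u := hp u
  have key := H ‖u0‖ ‖ub‖ ‖pb‖ (√(a u u)) (‖F‖ + ‖G‖) (norm_nonneg _) (norm_nonneg _)
    (norm_nonneg _) (Real.sqrt_nonneg _) (by positivity) ?_ ?_ ?_ ?_
  · have : ‖u‖ ≤ ‖u0‖ + ‖ub‖ := by rw [hu]; exact norm_add_le _ _
    linarith
  · refine (hB1 pb mb).trans ?_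
    refine ContinuousLinearMap.opNorm_le_bound _ (by positivity) fun v => ?_
    rw [ContinuousLinearMap.flip_apply, ← hbp, Real.norm_eq_abs]
    have h1 : b v p = F v - a u v := by linarith [e1 v]
    have h2 : |a u v| ≤ √Na * √(a u u) * ‖v‖ := by
      refine abs_le_of_sq_le_sq ?_ (by positivity)
      rw [mul_pow, mul_pow, Real.sq_sqrt hNa, Real.sq_sqrt hE]
      refine (st_cs a hs hp u v).trans ?_
      have := (le_abs_self _).trans (st_apply_le a hN v v)
      nlinarith [mul_le_mul_of_nonneg_left this hE]
    have h3 := st_abs F v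
    rw [h1]
    refine (abs_sub _ _).trans ?_
    nlinarith [mul_nonneg (norm_nonneg G) (norm_nonneg v)]
  · refine (hB2 ub hub).trans ?_
    rw [← hbu]
    refine ContinuousLinearMap.opNorm_le_bound _ (by positivity) fun q => ?_
    obtain ⟨q0, hq0, qb, hqb, hq⟩ :=
      (LinearMap.ker b.flip.toLinearMap).exists_add_mem_mem_orthogonal q
    have hbq : b u q = b u qb := by
      have h : b.flip q0 = 0 := hq0
      have : b u q0 = 0 := by simpa using congrArg (fun l => l u) h
      rw [hq, map_add, this, zero_add]
    have hqn : ‖qb‖ ≤ ‖q‖ := by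
      have : ‖q‖ * ‖q‖ = ‖q0‖ * ‖q0‖ + ‖qb‖ * ‖qb‖ := by
        rw [hq]; exact norm_add_sq_eq_norm_sq_add_norm_sq_of_inner_eq_zero _ _ (hqb q0 hq0)
      nlinarith [norm_nonneg q, norm_nonneg qb, mul_self_nonneg ‖q0‖]
    have hin : ⟪p, qb⟫ = ⟪pb, qb⟫ := by
      rw [hpp, inner_add_left, hqb p₀ m0, zero_add]
    have h1 : b u q = G qb + lam * ⟪pb, qb⟫ := by
      rw [hbq, ← hin]; linarith [e2 qb]
    rw [h1, Real.norm_eq_abs]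
    refine (abs_add_le _ _).trans ?_
    rw [abs_mul, abs_of_pos hlam]
    have h3 := st_abs G qb
    have h4 := abs_real_inner_le_norm pb qb
    calc |G qb| + lam * |⟪pb, qb⟫| ≤ ‖G‖ * ‖q‖ + Lam * (‖pb‖ * ‖q‖) := by
          gcongr
          · exact h3.trans (by gcongr)
          · exact h4.trans (by gcongr)
      _ ≤ _ := by nlinarith [mul_nonneg (norm_nonneg F) (norm_nonneg q)]
  · have h1 := hco u0 hu0
    have h2 : a u0 u0 = F u0 - a ub u0 := by
      have := e1 u0
      rw [hbu0] at this
      simp only [zero_apply, add_zero] at this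
      rw [← this, hu]; simp
    have h3 := (le_abs_self _).trans (st_abs F u0)
    have h4 := (neg_le_abs _).trans (st_apply_le a hN ub u0)
    rcases (norm_nonneg u0).eq_or_lt with h | h
    · rw [← h]; simp; positivity
    · refine le_of_mul_le_mul_right ?_ h
      nlinarith [mul_nonneg (norm_nonneg G) (norm_nonneg u0)]
  · rw [Real.sq_sqrt hE]
    have h1 := e1 u
    have h2 := e2 pb
    have hin : ⟪p, pb⟫ = ⟪pb, pb⟫ := by
      rw [hpp, inner_add_left, mb p₀ m0, zero_add]
    rw [hin, ← hbp] at h2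
    have h5 : 0 ≤ lam * ⟪pb, pb⟫ := mul_nonneg hlam.le real_inner_self_nonneg
    have h3 := (le_abs_self _).trans (st_abs F u)
    have h4 := (neg_le_abs _).trans (st_abs G pb)
    have : ‖u‖ ≤ ‖u0‖ + ‖ub‖ := by rw [hu]; exact norm_add_le _ _
    calc a u u ≤ ‖F‖ * ‖u‖ + ‖G‖ * ‖pb‖ := by linarith
      _ ≤ ‖F‖ * (‖u0‖ + ‖ub‖) + ‖G‖ * ‖pb‖ := by gcongr
      _ ≤ _ := by
        nlinarith [mul_nonneg (norm_nonneg F) (norm_nonneg pb), mul_nonneg (norm_nonneg G) (norm_nonneg u0),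
          mul_nonneg (norm_nonneg G) (norm_nonneg ub)]

lemma st_p0 {V Q : Type} [NormedAddCommGroup V] [InnerProductSpace ℝ V]
    [NormedAddCommGroup Q] [InnerProductSpace ℝ Q] (b : V →L[ℝ] Q →L[ℝ] ℝ) (lam : ℝ) (hlam : 0 < lam)
    (G G0 : Q →L[ℝ] ℝ) (u : V) (p p₀ pb : Q) (e2 : ∀ q, b u q - lam * ⟪p, q⟫ = G q)
    (m0 : p₀ ∈ LinearMap.ker b.flip.toLinearMap) (mb : pb ∈ (LinearMap.ker b.flip.toLinearMap)ᗮ)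
    (hpp : p = p₀ + pb) (hG : ∀ q ∈ LinearMap.ker b.flip.toLinearMap, G0 q = G q) :
    ‖p₀‖ ≤ lam⁻¹ * ‖G0‖ := by
  have h0 : b u p₀ = 0 := by
    have : b.flip p₀ = 0 := m0
    simpa using congrArg (fun l => l u) this
  have h1 := e2 p₀
  have hin : ⟪p, p₀⟫ = ‖p₀‖ * ‖p₀‖ := by
    rw [hpp, inner_add_left, real_inner_comm p₀ pb, mb p₀ m0, add_zero,
      real_inner_self_eq_norm_mul_norm]
  rw [h0, hin, ← hG _ m0] at h1
  have h4 := (neg_le_abs _).trans (st_abs G0 p₀)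
  rw [inv_mul_eq_div, le_div_iff₀ hlam]
  rcases (norm_nonneg p₀).eq_or_lt with h | h
  · rw [← h]; simp
  · refine le_of_mul_le_mul_right ?_ h
    nlinarith

/-- Riesz map as a real continuous linear map. -/
noncomputable def rieszR (Q : Type) [NormedAddCommGroup Q] [InnerProductSpace ℝ Q] [CompleteSpace Q] :
    (Q →L[ℝ] ℝ) →L[ℝ] Q :=
  LinearMap.mkContinuous
    { toFun := fun G => (InnerProductSpace.toDual ℝ Q).symm G
      map_add' := fun x y => map_add _ x y
      map_smul' := fun c x => by simp } 1 (fun G => by simp)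

lemma rieszR_inner {Q : Type} [NormedAddCommGroup Q] [InnerProductSpace ℝ Q] [CompleteSpace Q]
    (G : Q →L[ℝ] ℝ) (q : Q) : ⟪rieszR Q G, q⟫ = G q :=
  InnerProductSpace.toDual_symm_apply

lemma st_exists (α₀ β Na : ℝ) (hα₀ : 0 < α₀) (hβ : 0 < β) (hNa : 0 ≤ Na) (V Q : Type)
    [NormedAddCommGroup V] [InnerProductSpace ℝ V] [CompleteSpace V]
    [NormedAddCommGroup Q] [InnerProductSpace ℝ Q] [CompleteSpace Q]
    (a : V →L[ℝ] V →L[ℝ] ℝ) (b : V →L[ℝ] Q →L[ℝ] ℝ)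
    (hs : ∀ v w : V, a v w = a w v) (hp : ∀ v : V, 0 ≤ a v v) (hN : ‖a‖ ≤ Na)
    (hco : ∀ v ∈ LinearMap.ker b.toLinearMap, α₀ * ‖v‖ ^ 2 ≤ a v v)
    (hB2 : ∀ v ∈ (LinearMap.ker b.toLinearMap)ᗮ, β * ‖v‖ ≤ ‖b v‖) (lam : ℝ) (hlam : 0 < lam) :
    ∃ (S1 : (V →L[ℝ] ℝ) →L[ℝ] V) (S2 : (Q →L[ℝ] ℝ) →L[ℝ] V)
      (S3 : (V →L[ℝ] ℝ) →L[ℝ] Q) (S4 : (Q →L[ℝ] ℝ) →L[ℝ] Q),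
      ∀ F G, (∀ v, a (S1 F + S2 G) v + b v (S3 F + S4 G) = F v) ∧
        (∀ q, b (S1 F + S2 G) q - lam * ⟪S3 F + S4 G, q⟫ = G q) := by
  let c : V →L[ℝ] V →L[ℝ] ℝ := a + lam⁻¹ • (b.flip.comp ((rieszR Q).comp b))
  have hc : ∀ v w, c v w = a v w + lam⁻¹ * b w (rieszR Q (b v)) := fun v w => by simp [c]
  have hbb : ∀ v, b v (rieszR Q (b v)) = ‖b v‖ ^ 2 := fun v => by
    rw [← rieszR_inner, real_inner_self_eq_norm_sq]
    congr 1
    exact (InnerProductSpace.toDual ℝ Q).symm.norm_map (b v)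
  have hcoer : IsCoercive c := by
    have hk : 0 < 2 / α₀ + (2 * Na / α₀ + 1) * lam / β ^ 2 := by positivity
    refine ⟨(2 / α₀ + (2 * Na / α₀ + 1) * lam / β ^ 2)⁻¹, by positivity, fun u => ?_⟩
    obtain ⟨u0, hu0, ub, hub, hu⟩ :=
      (LinearMap.ker b.toLinearMap).exists_add_mem_mem_orthogonal u
    have hbu0 : b u0 = 0 := hu0
    have hbu : b u = b ub := by rw [hu, map_add, hbu0, zero_add]
    have hX : c u u = a u u + lam⁻¹ * ‖b u‖ ^ 2 := by rw [hc, hbb]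
    have hX1 : a u u ≤ c u u := by rw [hX]; have := hp u; simp; positivity
    have hX2 : ‖b u‖ ^ 2 ≤ lam * c u u := by
      rw [hX, mul_add, mul_inv_cancel_left₀ hlam.ne']
      have := mul_nonneg hlam.le (hp u); linarith
    have hy : ‖ub‖ ^ 2 ≤ lam * c u u / β ^ 2 := by
      rw [le_div_iff₀ (by positivity)]
      refine le_trans ?_ hX2
      rw [hbu, ← mul_pow, mul_comm]
      gcongr
      exact hB2 ub hub
    have hx : ‖u0‖ ^ 2 ≤ (2 * c u u + 2 * Na * ‖ub‖ ^ 2) / α₀ := by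
      rw [le_div_iff₀ hα₀, mul_comm]
      refine (hco u0 hu0).trans ?_
      have h1 : 0 ≤ a (u + ub) (u + ub) := hp _
      have h2 := (le_abs_self _).trans (st_apply_le a hN ub ub)
      have h3 : a u0 u0 = a u u - 2 * a u ub + a ub ub := by
        have : u0 = u - ub := by rw [hu]; simp
        rw [this]; simp [hs ub u]; ring
      have h4 : a (u + ub) (u + ub) = a u u + 2 * a u ub + a ub ub := by
        simp [hs ub u]; ring
      rw [h3]; nlinarith
    have hsum : ‖u‖ * ‖u‖ = ‖u0‖ * ‖u0‖ + ‖ub‖ * ‖ub‖ := by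
      rw [hu]; exact norm_add_sq_eq_norm_sq_add_norm_sq_of_inner_eq_zero _ _ (hub u0 hu0)
    rw [mul_assoc, inv_mul_le_iff₀ hk, hsum, ← sq, ← sq]
    calc ‖u0‖ ^ 2 + ‖ub‖ ^ 2 ≤ (2 * c u u + 2 * Na * ‖ub‖ ^ 2) / α₀ + ‖ub‖ ^ 2 := by linarith
      _ = 2 / α₀ * c u u + (2 * Na / α₀ + 1) * ‖ub‖ ^ 2 := by field_simp; ring
      _ ≤ 2 / α₀ * c u u + (2 * Na / α₀ + 1) * (lam * c u u / β ^ 2) := by gcongr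
      _ = _ := by ring
  let e := hcoer.continuousLinearEquivOfBilin
  have he : ∀ (w v : V), c (e.symm w) v = ⟪w, v⟫ := fun w v => by
    rw [← hcoer.continuousLinearEquivOfBilin_apply]
    exact congrArg (fun z => ⟪z, v⟫) (e.apply_symm_apply w)
  let S1 : (V →L[ℝ] ℝ) →L[ℝ] V := (e.symm : V →L[ℝ] V).comp (rieszR V)
  let S2 : (Q →L[ℝ] ℝ) →L[ℝ] V := lam⁻¹ • S1.comp (b.flip.comp (rieszR Q))
  let S3 : (V →L[ℝ] ℝ) →L[ℝ] Q := lam⁻¹ • (rieszR Q).comp (b.comp S1)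
  let S4 : (Q →L[ℝ] ℝ) →L[ℝ] Q := lam⁻¹ • ((rieszR Q).comp (b.comp S2) - rieszR Q)
  have hS1 : ∀ F v, c (S1 F) v = F v := fun F v => by
    simp only [S1, ContinuousLinearMap.comp_apply]
    exact (he _ _).trans (rieszR_inner _ _)
  have hS2 : ∀ G v, c (S2 G) v = lam⁻¹ * b v (rieszR Q G) := fun G v => by
    simp only [S2, smul_apply, ContinuousLinearMap.comp_apply, map_smul,
      hS1, ContinuousLinearMap.flip_apply, smul_eq_mul]
  refine ⟨S1, S2, S3, S4, fun F G => ?_⟩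
  have hP : S3 F + S4 G = lam⁻¹ • (rieszR Q (b (S1 F + S2 G)) - rieszR Q G) := by
    simp only [S3, S4, smul_apply, ContinuousLinearMap.comp_apply,
      sub_apply, map_add]
    module
  rw [hP]
  refine ⟨fun v => ?_, fun q => ?_⟩
  · have h1 : c (S1 F + S2 G) v = F v + lam⁻¹ * b v (rieszR Q G) := by
      rw [map_add, add_apply, hS1, hS2]
    rw [hc] at h1
    rw [map_smul, map_sub, smul_eq_mul]
    linarith
  · rw [inner_smul_left, inner_sub_left, rieszR_inner, rieszR_inner]
    simp only [conj_trivial]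
    field_simp; ring

lemma vk_int {E : Type} [NormedAddCommGroup E] [NormedSpace ℝ E] (μ : Measure ℝ) [IsFiniteMeasure μ]
    (k : ℝ → ℝ → ℝ) (hk : Measurable (Function.uncurry k)) (C : ℝ) (hC : ∀ t s, |k t s| ≤ C)
    (y : ℝ → E) (hy : Integrable y μ) :
    Integrable (fun ts : ℝ × ℝ => k ts.1 ts.2 • y ts.2) (μ.prod μ) :=
  (hy.comp_snd μ).bdd_smul C hk.aestronglyMeasurable (Filter.Eventually.of_forall fun ts => hC ts.1 ts.2)

lemma vk_int1 {E : Type} [NormedAddCommGroup E] [NormedSpace ℝ E] (μ : Measure ℝ)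
    (k : ℝ → ℝ → ℝ) (hk : Measurable (Function.uncurry k)) (C : ℝ) (hC : ∀ t s, |k t s| ≤ C)
    (y : ℝ → E) (hy : Integrable y μ) (t : ℝ) :
    Integrable (fun s : ℝ => k t s • y s) μ :=
  hy.bdd_smul C (hk.comp measurable_prodMk_left).aestronglyMeasurable
    (Filter.Eventually.of_forall fun s => hC t s)

lemma vk_bound {E : Type} [NormedAddCommGroup E] [NormedSpace ℝ E] (μ : Measure ℝ) [IsFiniteMeasure μ]
    (k : ℝ → ℝ → ℝ) (hk : Measurable (Function.uncurry k)) (C c : ℝ) (hC : ∀ t s, |k t s| ≤ C)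
    (hc : ∀ s, ∫ t, |k t s| ∂μ ≤ c)
    (y : ℝ → E) (hy : Integrable y μ) :
    ∫ t, ‖∫ s, k t s • y s ∂μ‖ ∂μ ≤ c * ∫ s, ‖y s‖ ∂μ := by
  have hi := vk_int μ k hk C hC y hy
  calc ∫ t, ‖∫ s, k t s • y s ∂μ‖ ∂μ ≤ ∫ t, ∫ s, ‖k t s • y s‖ ∂μ ∂μ := by
        refine integral_mono hi.integral_prod_left.norm hi.norm.integral_prod_left fun t => ?_
        exact norm_integral_le_integral_norm _
    _ = ∫ s, ∫ t, ‖k t s • y s‖ ∂μ ∂μ := integral_integral_swap hi.norm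
    _ ≤ ∫ s, c * ‖y s‖ ∂μ := by
        refine integral_mono hi.norm.integral_prod_right (hy.norm.const_mul c) fun s => ?_
        simp only [norm_smul, Real.norm_eq_abs]
        rw [integral_mul_const]
        exact mul_le_mul_of_nonneg_right (hc s) (norm_nonneg _)
    _ = _ := integral_const_mul _ _

lemma vk_exp (T m C : ℝ) (hm : 0 < m) (hC : 0 ≤ C) (k : ℝ → ℝ → ℝ)
    (hk : Measurable (Function.uncurry k))
    (h1 : ∀ t s, |k t s| ≤ C) (h2 : ∀ t s, t < s → k t s = 0) :
    Measurable (Function.uncurry fun t s => Real.exp (-m * (t - s)) * k t s) ∧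
    (∀ t s, |Real.exp (-m * (t - s)) * k t s| ≤ C) ∧
    ∀ s, ∫ t, |Real.exp (-m * (t - s)) * k t s| ∂(volume.restrict (Set.Ioc 0 T)) ≤ C / m := by
  have hb : ∀ t s, |Real.exp (-m * (t - s)) * k t s| ≤
      (Set.Ici s).indicator (fun t => C * Real.exp (m * s) * Real.exp (-m * t)) t := by
    intro t s
    rcases lt_or_ge t s with h | h
    · rw [h2 t s h]; simp [Set.indicator, not_le.2 h]
    · rw [Set.indicator_of_mem (Set.mem_Ici.2 h), abs_mul, abs_of_pos (Real.exp_pos _), mul_assoc,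
        ← Real.exp_add, mul_comm]
      have : m * s + -m * t = -m * (t - s) := by ring
      rw [this]
      exact mul_le_mul_of_nonneg_right (h1 t s) (Real.exp_pos _).le
  have hmeas : Measurable (Function.uncurry fun t s => Real.exp (-m * (t - s)) * k t s) := by
    refine Measurable.mul ?_ hk
    fun_prop
  refine ⟨hmeas, ?_, ?_⟩
  · intro t s
    rcases lt_or_ge t s with h | h
    · rw [h2 t s h]; simpa
    · rw [abs_mul, abs_of_pos (Real.exp_pos _)]
      have : Real.exp (-m * (t - s)) ≤ 1 := by
        rw [Real.exp_le_one_iff]; nlinarith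
      calc _ ≤ 1 * C := mul_le_mul this (h1 t s) (abs_nonneg _) zero_le_one
        _ = C := one_mul C
  · intro s
    have hint : Integrable ((Set.Ici s).indicator (fun t => C * Real.exp (m * s) * Real.exp (-m * t))) volume := by
      rw [integrable_indicator_iff measurableSet_Ici, integrableOn_Ici_iff_integrableOn_Ioi]
      exact (integrableOn_exp_mul_Ioi (by linarith) s).const_mul _
    calc _ ≤ ∫ t in Set.Ioc 0 T, (Set.Ici s).indicator (fun t => C * Real.exp (m * s) * Real.exp (-m * t)) t :=
          integral_mono_of_nonneg (Filter.Eventually.of_forall fun t => abs_nonneg _) hint.integrableOn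
            (Filter.Eventually.of_forall fun t => hb t s)
      _ ≤ ∫ t, (Set.Ici s).indicator (fun t => C * Real.exp (m * s) * Real.exp (-m * t)) t :=
          setIntegral_le_integral hint (Filter.Eventually.of_forall fun t =>
            Set.indicator_nonneg (fun t _ => by positivity) t)
      _ = C / m := by
          rw [integral_indicator measurableSet_Ici, integral_Ici_eq_integral_Ioi, integral_const_mul,
            integral_exp_mul_Ioi (by linarith)]
          have : Real.exp (m * s) * Real.exp (-(m * s)) = 1 := by rw [← Real.exp_add]; simp
          field_simp
          linear_combination C * this

lemma gronw (T M : ℝ) (hM : 0 ≤ M) : ∃ D : ℝ, 0 < D ∧ ∀ w d : ℝ → ℝ,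
    Integrable w (volume.restrict (Set.Ioc 0 T)) → Integrable d (volume.restrict (Set.Ioc 0 T)) →
    (∀ t, 0 ≤ w t) → (∀ t, 0 ≤ d t) →
    (∀ᵐ t ∂(volume.restrict (Set.Ioc 0 T)), w t ≤ d t +
      M * ∫ s, (if s ≤ t then (1:ℝ) else 0) * w s ∂(volume.restrict (Set.Ioc 0 T))) →
    ∫ t, w t ∂(volume.restrict (Set.Ioc 0 T)) ≤ D * ∫ t, d t ∂(volume.restrict (Set.Ioc 0 T)) := by
  set μ := volume.restrict (Set.Ioc (0:ℝ) T) with hμ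
  obtain ⟨m, hm⟩ : ∃ m, m = 2 * (M + 1) := ⟨_, rfl⟩
  have hmp : 0 < m := by rw [hm]; positivity
  refine ⟨Real.exp (m * T) * 2, by positivity, fun w d hw hd hw0 hd0 h => ?_⟩
  have hkm : Measurable (Function.uncurry fun t s : ℝ => if s ≤ t then M else 0) := by
    refine Measurable.ite ?_ measurable_const measurable_const
    exact measurableSet_le measurable_snd measurable_fst
  obtain ⟨k1, k2, k3⟩ := vk_exp T m M hmp hM (fun t s : ℝ => if s ≤ t then M else 0) hkm
    (fun t s => by by_cases h : s ≤ t <;> simp [h, hM, abs_of_nonneg]) (fun t s h => by simp [not_le.2 h])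
  have hpos : ∀ᵐ t ∂μ, t ∈ Set.Ioc 0 T := ae_restrict_mem measurableSet_Ioc
  have hexpm : ∀ y : ℝ → ℝ, Integrable y μ → Integrable (fun t => Real.exp (-m * t) * y t) μ := by
    intro y hy
    refine hy.bdd_mul (c := 1) (by fun_prop) ?_
    filter_upwards [hpos] with t ht
    rw [Real.norm_eq_abs, abs_of_pos (Real.exp_pos _), Real.exp_le_one_iff]
    nlinarith [ht.1]
  have hw' := hexpm w hw
  have hd' := hexpm d hd
  have hB := vk_bound μ _ k1 M _ k2 k3 _ hw'
  have hI := (vk_int μ _ k1 M k2 _ hw').integral_prod_left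
  have hle : ∫ t, Real.exp (-m * t) * w t ∂μ ≤ ∫ t, Real.exp (-m * t) * d t ∂μ +
      ∫ t, ‖∫ s, (Real.exp (-m * (t - s)) * if s ≤ t then M else 0) • (Real.exp (-m * s) * w s) ∂μ‖ ∂μ := by
    rw [← integral_add hd' hI.norm]
    refine integral_mono_ae hw' (hd'.add hI.norm) ?_
    filter_upwards [h] with t ht
    have e : ∫ s, (Real.exp (-m * (t - s)) * if s ≤ t then M else 0) • (Real.exp (-m * s) * w s) ∂μ =
        Real.exp (-m * t) * (M * ∫ s, (if s ≤ t then (1:ℝ) else 0) * w s ∂μ) := by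
      rw [← integral_const_mul, ← integral_const_mul]
      congr 1; ext s
      have : Real.exp (-m * (t - s)) * Real.exp (-m * s) = Real.exp (-m * t) := by
        rw [← Real.exp_add]; congr 1; ring
      rw [← this, smul_eq_mul]
      split_ifs <;> ring
    show _ ≤ Real.exp (-m * t) * d t + _
    rw [e]
    refine le_trans ?_ (add_le_add le_rfl (le_abs_self _))
    rw [← mul_add]
    exact mul_le_mul_of_nonneg_left ht (Real.exp_pos _).le
  have hnorm : ∫ s, ‖Real.exp (-m * s) * w s‖ ∂μ = ∫ s, Real.exp (-m * s) * w s ∂μ := by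
    congr 1; ext s; rw [Real.norm_eq_abs, abs_of_nonneg (mul_nonneg (Real.exp_pos _).le (hw0 s))]
  rw [hnorm] at hB
  have hMm : M / m ≤ 1 / 2 := by rw [hm, div_le_div_iff₀ (by positivity) (by norm_num)]; linarith
  have hWn : 0 ≤ ∫ s, Real.exp (-m * s) * w s ∂μ :=
    integral_nonneg fun s => mul_nonneg (Real.exp_pos _).le (hw0 s)
  have h1 : ∫ t, Real.exp (-m * t) * w t ∂μ ≤ 2 * ∫ t, Real.exp (-m * t) * d t ∂μ := by
    have := mul_le_mul_of_nonneg_right hMm hWn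
    linarith
  have h2 : ∫ t, Real.exp (-m * t) * d t ∂μ ≤ ∫ t, d t ∂μ := by
    refine integral_mono_ae hd' hd ?_
    filter_upwards [hpos] with t ht
    refine mul_le_of_le_one_left (hd0 t) ?_
    rw [Real.exp_le_one_iff]
    nlinarith [ht.1]
  have h3 : ∫ t, w t ∂μ ≤ Real.exp (m * T) * ∫ t, Real.exp (-m * t) * w t ∂μ := by
    rw [← integral_const_mul]
    refine integral_mono_ae hw (hw'.const_mul _) ?_
    filter_upwards [hpos] with t ht
    rw [← mul_assoc, ← Real.exp_add]
    refine le_mul_of_one_le_left (hw0 t) ?_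
    rw [Real.one_le_exp_iff]
    nlinarith [ht.2]
  calc _ ≤ _ := h3
    _ ≤ Real.exp (m * T) * (2 * ∫ t, d t ∂μ) := by gcongr; linarith
    _ = _ := by ring

lemma volt_contr {E : Type} [NormedAddCommGroup E] [NormedSpace ℝ E] [CompleteSpace E]
    (μ : Measure ℝ) [IsFiniteMeasure μ]
    (k₁ k₂ : ℝ → ℝ → ℝ) (hk₁ : Measurable (Function.uncurry k₁)) (hk₂ : Measurable (Function.uncurry k₂))
    (C₁ C₂ c₁ c₂ : ℝ) (hC₁ : ∀ t s, |k₁ t s| ≤ C₁) (hC₂ : ∀ t s, |k₂ t s| ≤ C₂)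
    (hc₁ : ∀ s, ∫ t, |k₁ t s| ∂μ ≤ c₁) (hc₂ : ∀ s, ∫ t, |k₂ t s| ∂μ ≤ c₂)
    (h₁ : 0 ≤ c₁) (h₂ : 0 ≤ c₂)
    (R₁ R₂ : E →L[ℝ] E) (hR : c₁ * ‖R₁‖ + c₂ * ‖R₂‖ ≤ 1 / 2) (h : ℝ → E) (hh : Integrable h μ) :
    ∃ x : ℝ → E, Integrable x μ ∧
      ∀ᵐ t ∂μ, x t = h t + (∫ s, k₁ t s • R₁ (x s) ∂μ + ∫ s, k₂ t s • R₂ (x s) ∂μ) := by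
  have hI : ∀ x : Lp E 1 μ, Integrable (fun t => h t +
      (∫ s, k₁ t s • R₁ (x s) ∂μ + ∫ s, k₂ t s • R₂ (x s) ∂μ)) μ := fun x => by
    have hx := L1.integrable_coeFn x
    exact hh.add ((vk_int μ k₁ hk₁ C₁ hC₁ _ (R₁.integrable_comp hx)).integral_prod_left.add
      (vk_int μ k₂ hk₂ C₂ hC₂ _ (R₂.integrable_comp hx)).integral_prod_left)
  let Φ : Lp E 1 μ → Lp E 1 μ := fun x => (hI x).toL1 _
  have hΦ : ContractingWith (1/2) Φ := by
    refine ⟨by rw [← NNReal.coe_lt_coe]; norm_num, LipschitzWith.of_dist_le_mul fun x y => ?_⟩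
    have hxy : Integrable (fun t => x t - y t) μ := (L1.integrable_coeFn x).sub (L1.integrable_coeFn y)
    have hj₁ := R₁.integrable_comp hxy
    have hj₂ := R₂.integrable_comp hxy
    rw [dist_eq_norm, dist_eq_norm, L1.norm_eq_integral_norm, L1.norm_eq_integral_norm]
    have e1 : ∫ t, ‖(x - y : Lp E 1 μ) t‖ ∂μ = ∫ t, ‖x t - y t‖ ∂μ := by
      refine integral_congr_ae ?_
      filter_upwards [Lp.coeFn_sub x y] with t ht
      rw [ht]; rfl
    have e2 : ∫ t, ‖(Φ x - Φ y : Lp E 1 μ) t‖ ∂μ = ∫ t, ‖∫ s, k₁ t s • R₁ (x s - y s) ∂μ +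
        ∫ s, k₂ t s • R₂ (x s - y s) ∂μ‖ ∂μ := by
      refine integral_congr_ae ?_
      filter_upwards [Lp.coeFn_sub (Φ x) (Φ y), (hI x).coeFn_toL1, (hI y).coeFn_toL1] with t ht h1 h2
      have q₁ := fun z : Lp E 1 μ => vk_int1 μ k₁ hk₁ C₁ hC₁ _ (R₁.integrable_comp (L1.integrable_coeFn z)) t
      have q₂ := fun z : Lp E 1 μ => vk_int1 μ k₂ hk₂ C₂ hC₂ _ (R₂.integrable_comp (L1.integrable_coeFn z)) t
      rw [ht, Pi.sub_apply, h1, h2]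
      simp only [map_sub, smul_sub]
      rw [integral_sub (q₁ x) (q₁ y), integral_sub (q₂ x) (q₂ y)]
      congr 1; abel
    rw [e1, e2]
    have i₁ := (vk_int μ k₁ hk₁ C₁ hC₁ _ hj₁).integral_prod_left
    have i₂ := (vk_int μ k₂ hk₂ C₂ hC₂ _ hj₂).integral_prod_left
    have b₁ := vk_bound μ k₁ hk₁ C₁ c₁ hC₁ hc₁ _ hj₁
    have b₂ := vk_bound μ k₂ hk₂ C₂ c₂ hC₂ hc₂ _ hj₂
    have n : ∀ R : E →L[ℝ] E, ∫ s, ‖R (x s - y s)‖ ∂μ ≤ ‖R‖ * ∫ s, ‖x s - y s‖ ∂μ := fun R => by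
      rw [← integral_const_mul]
      exact integral_mono (R.integrable_comp hxy).norm (hxy.norm.const_mul _) fun s => R.le_opNorm _
    have hn : 0 ≤ ∫ s, ‖x s - y s‖ ∂μ := integral_nonneg fun s => norm_nonneg _
    calc _ ≤ ∫ t, (‖∫ s, k₁ t s • R₁ (x s - y s) ∂μ‖ + ‖∫ s, k₂ t s • R₂ (x s - y s) ∂μ‖) ∂μ :=
          integral_mono (i₁.add i₂).norm (i₁.norm.add i₂.norm) fun t => norm_add_le _ _
      _ = _ := integral_add i₁.norm i₂.norm
      _ ≤ c₁ * (‖R₁‖ * ∫ s, ‖x s - y s‖ ∂μ) + c₂ * (‖R₂‖ * ∫ s, ‖x s - y s‖ ∂μ) :=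
          add_le_add (b₁.trans (mul_le_mul_of_nonneg_left (n R₁) h₁))
            (b₂.trans (mul_le_mul_of_nonneg_left (n R₂) h₂))
      _ = (c₁ * ‖R₁‖ + c₂ * ‖R₂‖) * ∫ s, ‖x s - y s‖ ∂μ := by ring
      _ ≤ 1 / 2 * ∫ s, ‖x s - y s‖ ∂μ := mul_le_mul_of_nonneg_right hR hn
      _ = _ := by norm_num
  obtain ⟨z, hf⟩ : ∃ z : Lp E 1 μ, Φ z = z := ⟨_, hΦ.fixedPoint_isFixedPt⟩
  refine ⟨z, L1.integrable_coeFn _, ?_⟩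
  have := (hI z).coeFn_toL1
  filter_upwards [this] with t ht
  exact (congrArg (fun z : Lp E 1 μ => z t) hf).symm.trans ht

lemma volt_exists {E : Type} [NormedAddCommGroup E] [NormedSpace ℝ E] [CompleteSpace E]
    (T : ℝ) (k₁ k₂ : ℝ → ℝ → ℝ) (hk₁ : Measurable (Function.uncurry k₁))
    (hk₂ : Measurable (Function.uncurry k₂))
    (C₁ C₂ : ℝ) (h₁ : 0 ≤ C₁) (h₂ : 0 ≤ C₂) (hC₁ : ∀ t s, |k₁ t s| ≤ C₁) (hC₂ : ∀ t s, |k₂ t s| ≤ C₂)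
    (hz₁ : ∀ t s, t < s → k₁ t s = 0) (hz₂ : ∀ t s, t < s → k₂ t s = 0)
    (R₁ R₂ : E →L[ℝ] E) (h : ℝ → E) (hh : Integrable h (volume.restrict (Set.Ioc 0 T))) :
    ∃ x : ℝ → E, Integrable x (volume.restrict (Set.Ioc 0 T)) ∧
      ∀ᵐ t ∂(volume.restrict (Set.Ioc 0 T)), x t = h t +
        (∫ s, k₁ t s • R₁ (x s) ∂(volume.restrict (Set.Ioc 0 T)) +
          ∫ s, k₂ t s • R₂ (x s) ∂(volume.restrict (Set.Ioc 0 T))) := by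
  set μ := volume.restrict (Set.Ioc (0:ℝ) T) with hμ
  obtain ⟨m, hm⟩ : ∃ m, m = 2 * (C₁ * ‖R₁‖ + C₂ * ‖R₂‖ + 1) := ⟨_, rfl⟩
  have hmp : 0 < m := by rw [hm]; positivity
  have hpos : ∀ᵐ t ∂μ, t ∈ Set.Ioc 0 T := ae_restrict_mem measurableSet_Ioc
  have hexpm : ∀ (n : ℝ) (y : ℝ → E), Integrable y μ → Integrable (fun t => Real.exp (n * t) • y t) μ := by
    intro n y hy
    refine hy.bdd_smul (Real.exp (|n| * T)) (φ := fun t => Real.exp (n * t))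
      (Continuous.aestronglyMeasurable (by fun_prop)) ?_
    filter_upwards [hpos] with t ht
    rw [Real.norm_eq_abs, abs_of_pos (Real.exp_pos _), Real.exp_le_exp]
    calc n * t ≤ |n| * t := mul_le_mul_of_nonneg_right (le_abs_self _) ht.1.le
      _ ≤ _ := mul_le_mul_of_nonneg_left ht.2 (abs_nonneg _)
  obtain ⟨a1, a2, a3⟩ := vk_exp T m C₁ hmp h₁ k₁ hk₁ hC₁ hz₁
  obtain ⟨b1, b2, b3⟩ := vk_exp T m C₂ hmp h₂ k₂ hk₂ hC₂ hz₂
  obtain ⟨y, hy, hey⟩ := volt_contr μ _ _ a1 b1 C₁ C₂ _ _ a2 b2 a3 b3 (by positivity) (by positivity)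
    R₁ R₂ (by
      have : C₁ / m * ‖R₁‖ + C₂ / m * ‖R₂‖ = (C₁ * ‖R₁‖ + C₂ * ‖R₂‖) / m := by ring
      rw [this, div_le_div_iff₀ hmp (by norm_num), hm]
      linarith) _ (hexpm (-m) h hh)
  refine ⟨fun t => Real.exp (m * t) • y t, hexpm m y hy, ?_⟩
  filter_upwards [hey] with t ht
  have key : ∀ (k : ℝ → ℝ → ℝ) (R : E →L[ℝ] E), Real.exp (m * t) •
      ∫ s, (Real.exp (-m * (t - s)) * k t s) • R (y s) ∂μ = ∫ s, k t s • R (Real.exp (m * s) • y s) ∂μ := by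
    intro k R
    rw [← integral_smul]
    congr 1; ext s
    rw [map_smul, smul_smul, smul_smul, ← mul_assoc, ← Real.exp_add, mul_comm (k t s)]
    congr 3; ring
  have e0 : Real.exp (m * t) * Real.exp (-m * t) = 1 := by rw [← Real.exp_add]; simp
  rw [← key k₁ R₁, ← key k₂ R₂, ht, smul_add, smul_add, smul_smul, e0, one_smul]

/-- Truncated kernel. -/
noncomputable def tk (T C : ℝ) (k : ℝ → ℝ → ℝ) (t s : ℝ) : ℝ :=
  if (0 < s ∧ s ≤ t ∧ t ≤ T) ∧ |k t s| ≤ C then k t s else 0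

lemma tk_meas (T C : ℝ) (k : ℝ → ℝ → ℝ) (hk : Measurable (Function.uncurry k)) :
    Measurable (Function.uncurry (tk T C k)) := by
  have : Function.uncurry (tk T C k) = fun x : ℝ × ℝ =>
      if (0 < x.2 ∧ x.2 ≤ x.1 ∧ x.1 ≤ T) ∧ |Function.uncurry k x| ≤ C then Function.uncurry k x else 0 := by
    ext ⟨t, s⟩; rfl
  rw [this]
  refine Measurable.ite ?_ hk measurable_const
  refine MeasurableSet.inter (MeasurableSet.inter ?_ (MeasurableSet.inter ?_ ?_)) ?_
  · exact measurableSet_lt measurable_const measurable_snd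
  · exact measurableSet_le measurable_snd measurable_fst
  · exact measurableSet_le measurable_fst measurable_const
  · exact measurableSet_le (by simpa [Real.norm_eq_abs] using hk.norm) measurable_const

lemma tk_le (T C : ℝ) (hC : 0 ≤ C) (k : ℝ → ℝ → ℝ) (t s : ℝ) : |tk T C k t s| ≤ C := by
  unfold tk; split_ifs with h
  · exact h.2
  · simpa

lemma tk_zero (T C : ℝ) (k : ℝ → ℝ → ℝ) (t s : ℝ) (h : t < s) : tk T C k t s = 0 := by
  unfold tk; rw [if_neg]; rintro ⟨⟨_, h1, _⟩, _⟩; linarith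

lemma tk_le' (T C : ℝ) (hC : 0 ≤ C) (k : ℝ → ℝ → ℝ) (t s : ℝ) :
    |tk T C k t s| ≤ C * (if s ≤ t then (1:ℝ) else 0) := by
  split_ifs with h
  · simpa using tk_le T C hC k t s
  · rw [tk_zero T C k t s (not_le.1 h)]; simp

lemma tk_ae (T C : ℝ) (k : ℝ → ℝ → ℝ)
    (h : ∀ᵐ ts : ℝ × ℝ ∂volume, 0 ≤ ts.2 → ts.2 ≤ ts.1 → ts.1 ≤ T → |k ts.1 ts.2| ≤ C) :
    ∀ᵐ t ∂(volume : Measure ℝ), ∀ᵐ s ∂(volume : Measure ℝ), t ≤ T → s ∈ Set.Ioc 0 t → k t s = tk T C k t s := by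
  rw [Measure.volume_eq_prod] at h
  filter_upwards [Measure.ae_ae_of_ae_prod h] with t ht
  filter_upwards [ht] with s hs h1 h2
  unfold tk; rw [if_pos ⟨⟨h2.1, h2.2, h1⟩, hs h2.1.le h2.2 h1⟩]

lemma ae_Icc (T : ℝ) (P : ℝ → Prop) :
    (∀ᵐ t ∂(volume : Measure ℝ), t ∈ Set.Icc 0 T → P t) ↔ ∀ᵐ t ∂(volume.restrict (Set.Ioc 0 T)), P t := by
  rw [← ae_restrict_iff' measurableSet_Icc, Measure.restrict_congr_set Ioc_ae_eq_Icc]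

section
variable {V Q : Type} [NormedAddCommGroup V] [InnerProductSpace ℝ V]
    [NormedAddCommGroup Q] [InnerProductSpace ℝ Q]

/-- Memory term. -/
noncomputable def memT (T : ℝ) (a : V →L[ℝ] V →L[ℝ] ℝ) (b : V →L[ℝ] Q →L[ℝ] ℝ) (k₁ k₂ : ℝ → ℝ → ℝ)
    (u : ℝ → V) (p : ℝ → Q) (t : ℝ) : V →L[ℝ] ℝ :=
  ∫ s, k₁ t s • a (u s) ∂(volume.restrict (Set.Ioc 0 T)) +
    ∫ s, k₂ t s • b.flip (p s) ∂(volume.restrict (Set.Ioc 0 T))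

lemma memT_apply (T : ℝ) (a : V →L[ℝ] V →L[ℝ] ℝ) (b : V →L[ℝ] Q →L[ℝ] ℝ) (k₁ k₂ : ℝ → ℝ → ℝ)
    (hk₁ : Measurable (Function.uncurry k₁)) (hk₂ : Measurable (Function.uncurry k₂)) (C₁ C₂ : ℝ)
    (hC₁ : ∀ t s, |k₁ t s| ≤ C₁) (hC₂ : ∀ t s, |k₂ t s| ≤ C₂)
    (u : ℝ → V) (p : ℝ → Q) (hu : Integrable u (volume.restrict (Set.Ioc 0 T)))
    (hp : Integrable p (volume.restrict (Set.Ioc 0 T))) (t : ℝ) (v : V) :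
    memT T a b k₁ k₂ u p t v =
      ∫ s, (k₁ t s * a (u s) v + k₂ t s * b v (p s)) ∂(volume.restrict (Set.Ioc 0 T)) := by
  have i₁ := vk_int1 _ k₁ hk₁ C₁ hC₁ _ (a.integrable_comp hu) t
  have i₂ := vk_int1 _ k₂ hk₂ C₂ hC₂ _ (b.flip.integrable_comp hp) t
  unfold memT
  rw [← integral_add i₁ i₂]
  exact ContinuousLinearMap.integral_apply (i₁.add i₂) v

lemma memT_add (T : ℝ) (a : V →L[ℝ] V →L[ℝ] ℝ) (b : V →L[ℝ] Q →L[ℝ] ℝ) (k₁ k₂ : ℝ → ℝ → ℝ)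
    (hk₁ : Measurable (Function.uncurry k₁)) (hk₂ : Measurable (Function.uncurry k₂)) (C₁ C₂ : ℝ)
    (hC₁ : ∀ t s, |k₁ t s| ≤ C₁) (hC₂ : ∀ t s, |k₂ t s| ≤ C₂)
    (u u' : ℝ → V) (p p' : ℝ → Q) (hu : Integrable u (volume.restrict (Set.Ioc 0 T)))
    (hp : Integrable p (volume.restrict (Set.Ioc 0 T)))
    (hu' : Integrable u' (volume.restrict (Set.Ioc 0 T)))
    (hp' : Integrable p' (volume.restrict (Set.Ioc 0 T))) (t : ℝ) :
    memT T a b k₁ k₂ (fun s => u s + u' s) (fun s => p s + p' s) t =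
      memT T a b k₁ k₂ u p t + memT T a b k₁ k₂ u' p' t := by
  have i₁ := vk_int1 _ k₁ hk₁ C₁ hC₁ _ (a.integrable_comp hu) t
  have i₂ := vk_int1 _ k₂ hk₂ C₂ hC₂ _ (b.flip.integrable_comp hp) t
  have j₁ := vk_int1 _ k₁ hk₁ C₁ hC₁ _ (a.integrable_comp hu') t
  have j₂ := vk_int1 _ k₂ hk₂ C₂ hC₂ _ (b.flip.integrable_comp hp') t
  unfold memT
  simp only [map_add, smul_add]
  rw [integral_add i₁ j₁, integral_add i₂ j₂]
  abel

lemma memT_sub (T : ℝ) (a : V →L[ℝ] V →L[ℝ] ℝ) (b : V →L[ℝ] Q →L[ℝ] ℝ) (k₁ k₂ : ℝ → ℝ → ℝ)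
    (hk₁ : Measurable (Function.uncurry k₁)) (hk₂ : Measurable (Function.uncurry k₂)) (C₁ C₂ : ℝ)
    (hC₁ : ∀ t s, |k₁ t s| ≤ C₁) (hC₂ : ∀ t s, |k₂ t s| ≤ C₂)
    (u u' : ℝ → V) (p p' : ℝ → Q) (hu : Integrable u (volume.restrict (Set.Ioc 0 T)))
    (hp : Integrable p (volume.restrict (Set.Ioc 0 T)))
    (hu' : Integrable u' (volume.restrict (Set.Ioc 0 T)))
    (hp' : Integrable p' (volume.restrict (Set.Ioc 0 T))) (t : ℝ) :
    memT T a b k₁ k₂ (fun s => u s - u' s) (fun s => p s - p' s) t =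
      memT T a b k₁ k₂ u p t - memT T a b k₁ k₂ u' p' t := by
  have h := memT_add T a b k₁ k₂ hk₁ hk₂ C₁ C₂ hC₁ hC₂ _ u' _ p' (hu.sub hu') (hp.sub hp') hu' hp' t
  simp only [Pi.sub_apply, sub_add_cancel] at h
  rw [eq_sub_iff_add_eq]
  exact h.symm

lemma memT_norm (T : ℝ) (a : V →L[ℝ] V →L[ℝ] ℝ) (b : V →L[ℝ] Q →L[ℝ] ℝ) (k₁ k₂ : ℝ → ℝ → ℝ)
    (C₁ C₂ Na Nb : ℝ) (h₁ : 0 ≤ C₁) (h₂ : 0 ≤ C₂) (hNa : ‖a‖ ≤ Na) (hNb : ‖b‖ ≤ Nb)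
    (hC₁ : ∀ t s, |k₁ t s| ≤ C₁ * (if s ≤ t then (1:ℝ) else 0))
    (hC₂ : ∀ t s, |k₂ t s| ≤ C₂ * (if s ≤ t then (1:ℝ) else 0))
    (u : ℝ → V) (p pb : ℝ → Q) (hu : Integrable u (volume.restrict (Set.Ioc 0 T)))
    (hp : Integrable pb (volume.restrict (Set.Ioc 0 T)))
    (hpb : ∀ s, b.flip (p s) = b.flip (pb s)) (t : ℝ) :
    ‖memT T a b k₁ k₂ u p t‖ ≤ (C₁ * Na + C₂ * Nb) *
      ∫ s, (if s ≤ t then (1:ℝ) else 0) * (‖u s‖ + ‖pb s‖) ∂(volume.restrict (Set.Ioc 0 T)) := by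
  have hNa0 := (norm_nonneg a).trans hNa
  have hNb0 := (norm_nonneg b).trans hNb
  have hi : Integrable (fun s => (if s ≤ t then (1:ℝ) else 0) * (‖u s‖ + ‖pb s‖))
      (volume.restrict (Set.Ioc 0 T)) := by
    refine (hu.norm.add hp.norm).bdd_mul (c := 1) ?_ ?_
    · exact (Measurable.ite measurableSet_Iic measurable_const measurable_const).aestronglyMeasurable
    · refine Filter.Eventually.of_forall fun s => ?_
      split_ifs <;> simp
  unfold memT
  rw [add_mul, ← integral_const_mul, ← integral_const_mul]
  refine (norm_add_le _ _).trans (add_le_add ?_ ?_)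
  · refine norm_integral_le_of_norm_le (hi.const_mul _) (Filter.Eventually.of_forall fun s => ?_)
    rw [norm_smul, Real.norm_eq_abs]
    have : ‖a (u s)‖ ≤ Na * (‖u s‖ + ‖pb s‖) :=
      (a.le_opNorm _).trans (mul_le_mul hNa (by simp) (norm_nonneg _) hNa0)
    calc _ ≤ (C₁ * (if s ≤ t then (1:ℝ) else 0)) * (Na * (‖u s‖ + ‖pb s‖)) :=
          mul_le_mul (hC₁ t s) this (norm_nonneg _) (by split_ifs <;> simp [h₁])
      _ = _ := by ring
  · refine norm_integral_le_of_norm_le (hi.const_mul _) (Filter.Eventually.of_forall fun s => ?_)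
    rw [norm_smul, Real.norm_eq_abs, hpb]
    have : ‖b.flip (pb s)‖ ≤ Nb * (‖u s‖ + ‖pb s‖) :=
      (b.flip.le_opNorm _).trans (mul_le_mul (by rwa [ContinuousLinearMap.opNorm_flip])
        (by simp) (norm_nonneg _) hNb0)
    calc _ ≤ (C₂ * (if s ≤ t then (1:ℝ) else 0)) * (Nb * (‖u s‖ + ‖pb s‖)) :=
          mul_le_mul (hC₂ t s) this (norm_nonneg _) (by split_ifs <;> simp [h₂])
      _ = _ := by ring

lemma solves_iff (T lam C₁ C₂ : ℝ) (h₁ : 0 ≤ C₁) (h₂ : 0 ≤ C₂)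
    (a : V →L[ℝ] V →L[ℝ] ℝ) (b : V →L[ℝ] Q →L[ℝ] ℝ) (k₁ k₂ : ℝ → ℝ → ℝ)
    (hk₁ : Measurable (Function.uncurry k₁)) (hk₂ : Measurable (Function.uncurry k₂))
    (hb₁ : ∀ᵐ ts : ℝ × ℝ ∂volume, 0 ≤ ts.2 → ts.2 ≤ ts.1 → ts.1 ≤ T → |k₁ ts.1 ts.2| ≤ C₁)
    (hb₂ : ∀ᵐ ts : ℝ × ℝ ∂volume, 0 ≤ ts.2 → ts.2 ≤ ts.1 → ts.1 ≤ T → |k₂ ts.1 ts.2| ≤ C₂)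
    (f : ℝ → V →L[ℝ] ℝ) (g : ℝ → Q →L[ℝ] ℝ) (u : ℝ → V) (p : ℝ → Q)
    (hu : Integrable u (volume.restrict (Set.Ioc 0 T)))
    (hp : Integrable p (volume.restrict (Set.Ioc 0 T))) :
    SolvesPlam V Q T lam a b k₁ k₂ f g u p ↔ ∀ᵐ t ∂(volume.restrict (Set.Ioc 0 T)),
      (∀ v, a (u t) v + b v (p t) = (f t + memT T a b (tk T C₁ k₁) (tk T C₂ k₂) u p t) v) ∧
      (∀ q, b (u t) q - lam * ⟪p t, q⟫ = g t q) := by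
  unfold SolvesPlam
  rw [ae_Icc]
  refine Filter.eventually_congr ?_
  filter_upwards [ae_restrict_of_ae (tk_ae T C₁ k₁ hb₁), ae_restrict_of_ae (tk_ae T C₂ k₂ hb₂),
    ae_restrict_mem measurableSet_Ioc] with t e₁ e₂ ht
  have key : ∀ v, ∫ s in (0:ℝ)..t, (k₁ t s * a (u s) v + k₂ t s * b v (p s)) =
      memT T a b (tk T C₁ k₁) (tk T C₂ k₂) u p t v := fun v => by
    rw [memT_apply T a b _ _ (tk_meas T C₁ k₁ hk₁) (tk_meas T C₂ k₂ hk₂) C₁ C₂ (tk_le T C₁ h₁ k₁)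
      (tk_le T C₂ h₂ k₂) u p hu hp, intervalIntegral.integral_of_le ht.1.le]
    rw [setIntegral_eq_of_subset_of_forall_sdiff_eq_zero measurableSet_Ioc
      (Set.Ioc_subset_Ioc_right ht.2 : Set.Ioc 0 t ⊆ Set.Ioc 0 T)]
    · refine setIntegral_congr_ae measurableSet_Ioc ?_
      filter_upwards [e₁, e₂] with s i₁ i₂ hs
      rw [i₁ ht.2 hs, i₂ ht.2 hs]
    · intro s hs
      have : t < s := by
        by_contra hc
        exact hs.2 ⟨hs.1.1, not_lt.1 hc⟩
      rw [tk_zero _ _ _ _ _ this, tk_zero _ _ _ _ _ this]; simp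
  simp only [key, add_apply]
end

/-- Under the λ-setup with closed range of `B` and the inf-sup
condition with constant `β > 0` on the orthogonal complements, for every
`λ ∈ (0,Λ]`, `f`, `g`, Problem (P_λ) has exactly one solution `(u,p)` (up to a.e.
equality), and with the decomposition `p = p₀ + p̄` and `g₀ = g ∘ P_H`, there is a
constant `C > 0` depending only on `α₀, β, ‖a‖, ‖b‖, C_{k₁}, C_{k₂}, T, Λ` —
independent of `λ` — with `‖u‖₁ + ‖p̄‖₁ ≤ C(‖f‖₁ + ‖g‖₁)` and
`‖p₀‖₁ ≤ λ⁻¹ ‖g₀‖₁`. -/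
theorem statement13
    (α₀ β Na Nb Ck1 Ck2 T Lam : ℝ)
    (hα₀ : 0 < α₀) (hβ : 0 < β) (hT : 0 < T) (hLam : 0 < Lam)
    (hNa : 0 ≤ Na) (hNb : 0 ≤ Nb) (hCk1 : 0 ≤ Ck1) (hCk2 : 0 ≤ Ck2) :
    ∃ C : ℝ, 0 < C ∧
      ∀ (V Q : Type)
        [NormedAddCommGroup V] [InnerProductSpace ℝ V] [CompleteSpace V]
        [NormedAddCommGroup Q] [InnerProductSpace ℝ Q] [CompleteSpace Q]
        (a : V →L[ℝ] V →L[ℝ] ℝ) (b : V →L[ℝ] Q →L[ℝ] ℝ)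
        (k₁ k₂ : ℝ → ℝ → ℝ),
        (∀ v w : V, a v w = a w v) → (∀ v : V, 0 ≤ a v v) →
        ‖a‖ ≤ Na → ‖b‖ ≤ Nb →
        (∀ v ∈ LinearMap.ker b.toLinearMap, α₀ * ‖v‖ ^ 2 ≤ a v v) →
        IsClosed (Set.range fun v : V => (b v : Q →L[ℝ] ℝ)) →
        (∀ q ∈ (LinearMap.ker b.flip.toLinearMap)ᗮ, β * ‖q‖ ≤ ‖b.flip q‖) →
        (∀ v ∈ (LinearMap.ker b.toLinearMap)ᗮ, β * ‖v‖ ≤ ‖b v‖) →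
        Measurable (Function.uncurry k₁) → Measurable (Function.uncurry k₂) →
        (∀ᵐ ts : ℝ × ℝ ∂volume,
          0 ≤ ts.2 → ts.2 ≤ ts.1 → ts.1 ≤ T → |k₁ ts.1 ts.2| ≤ Ck1) →
        (∀ᵐ ts : ℝ × ℝ ∂volume,
          0 ≤ ts.2 → ts.2 ≤ ts.1 → ts.1 ≤ T → |k₂ ts.1 ts.2| ≤ Ck2) →
        ∀ lam : ℝ, 0 < lam → lam ≤ Lam →
        ∀ (f : ℝ → V →L[ℝ] ℝ) (g : ℝ → Q →L[ℝ] ℝ),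
        IntervalIntegrable f volume 0 T → IntervalIntegrable g volume 0 T →
        ∃ (u : ℝ → V) (p : ℝ → Q),
          IntervalIntegrable u volume 0 T ∧ IntervalIntegrable p volume 0 T ∧
          SolvesPlam V Q T lam a b k₁ k₂ f g u p ∧
          (∀ (u' : ℝ → V) (p' : ℝ → Q),
            IntervalIntegrable u' volume 0 T → IntervalIntegrable p' volume 0 T →
            SolvesPlam V Q T lam a b k₁ k₂ f g u' p' →
            ∀ᵐ t ∂volume, t ∈ Set.Icc (0:ℝ) T → u' t = u t ∧ p' t = p t) ∧
          ∀ (p₀ pbar : ℝ → Q) (g₀ : ℝ → Q →L[ℝ] ℝ),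
            (∀ t : ℝ, p₀ t ∈ LinearMap.ker b.flip.toLinearMap ∧
              pbar t ∈ (LinearMap.ker b.flip.toLinearMap)ᗮ ∧ p t = p₀ t + pbar t) →
            (∀ t : ℝ, (∀ q ∈ LinearMap.ker b.flip.toLinearMap, g₀ t q = g t q) ∧
              (∀ q ∈ (LinearMap.ker b.flip.toLinearMap)ᗮ, g₀ t q = 0)) →
            (∫ t in (0:ℝ)..T, ‖u t‖) + (∫ t in (0:ℝ)..T, ‖pbar t‖)
              ≤ C * ((∫ t in (0:ℝ)..T, ‖f t‖) + ∫ t in (0:ℝ)..T, ‖g t‖) ∧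
            (∫ t in (0:ℝ)..T, ‖p₀ t‖) ≤ lam⁻¹ * ∫ t in (0:ℝ)..T, ‖g₀ t‖ := by
  obtain ⟨C0, hC0, hest⟩ := st_est α₀ β Na Lam hα₀ hβ hLam hNa
  obtain ⟨D, hD, hgr⟩ := gronw T (C0 * (Ck1 * Na + Ck2 * Nb)) (by positivity)
  refine ⟨D * C0, by positivity, ?_⟩
  intro V Q _ _ _ _ _ _ a b k₁ k₂ hs hpos ha hb hco _ hB1 hB2 hk₁ hk₂ hbd₁ hbd₂ lam hlam hlam2 f g hf hg
  have hii : ∀ {E : Type} [NormedAddCommGroup E] (x : ℝ → E), IntervalIntegrable x volume 0 T ↔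
      Integrable x (volume.restrict (Set.Ioc 0 T)) := fun x =>
    intervalIntegrable_iff_integrableOn_Ioc_of_le hT.le
  have hest' := hest V Q a b hs hpos ha hco hB1 hB2 lam hlam hlam2
  simp only [hii, intervalIntegral.integral_of_le hT.le] at hf hg ⊢
  have hsol := fun (f : ℝ → V →L[ℝ] ℝ) (g : ℝ → Q →L[ℝ] ℝ) u p =>
    solves_iff T lam Ck1 Ck2 hCk1 hCk2 a b k₁ k₂ hk₁ hk₂ hbd₁ hbd₂ f g u p
  have mk₁ := tk_meas T Ck1 k₁ hk₁
  have mk₂ := tk_meas T Ck2 k₂ hk₂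
  have lk₁ := tk_le T Ck1 hCk1 k₁
  have lk₂ := tk_le T Ck2 hCk2 k₂
  have hmn := memT_norm T a b (tk T Ck1 k₁) (tk T Ck2 k₂) Ck1 Ck2 Na Nb hCk1 hCk2 ha hb
    (tk_le' T Ck1 hCk1 k₁) (tk_le' T Ck2 hCk2 k₂)
  have hms := memT_sub T a b _ _ mk₁ mk₂ Ck1 Ck2 lk₁ lk₂
  have hma := memT_add T a b _ _ mk₁ mk₂ Ck1 Ck2 lk₁ lk₂
  have hmi : ∀ (u : ℝ → V) (p : ℝ → Q), Integrable u (volume.restrict (Set.Ioc 0 T)) →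
      Integrable p (volume.restrict (Set.Ioc 0 T)) →
      Integrable (memT T a b (tk T Ck1 k₁) (tk T Ck2 k₂) u p) (volume.restrict (Set.Ioc 0 T)) := by
    intro u p hu hp
    exact (vk_int _ _ mk₁ Ck1 lk₁ _ (a.integrable_comp hu)).integral_prod_left.add
      (vk_int _ _ mk₂ Ck2 lk₂ _ (b.flip.integrable_comp hp)).integral_prod_left
  set μ := volume.restrict (Set.Ioc (0:ℝ) T) with hμ
  set κ₁ := tk T Ck1 k₁
  set κ₂ := tk T Ck2 k₂
  set H := LinearMap.ker b.flip.toLinearMap with hH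
  -- a priori estimate
  have apri : ∀ (f : ℝ → V →L[ℝ] ℝ) (g : ℝ → Q →L[ℝ] ℝ) (u : ℝ → V) (p p₀ pb : ℝ → Q),
      Integrable f μ → Integrable g μ → Integrable u μ → Integrable pb μ →
      (∀ t, p₀ t ∈ H ∧ pb t ∈ Hᗮ ∧ p t = p₀ t + pb t) →
      (∀ᵐ t ∂μ, (∀ v, a (u t) v + b v (p t) = (f t + memT T a b κ₁ κ₂ u p t) v) ∧
        (∀ q, b (u t) q - lam * ⟪p t, q⟫ = g t q)) →
      ∫ t, (‖u t‖ + ‖pb t‖) ∂μ ≤ D * C0 * (∫ t, ‖f t‖ ∂μ + ∫ t, ‖g t‖ ∂μ) := by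
    intro f g u p p₀ pb hf hg hu hpb hdec hsl
    have hfl : ∀ s, b.flip (p s) = b.flip (pb s) := fun s => by
      have h0 : b.flip (p₀ s) = 0 := (hdec s).1
      rw [(hdec s).2.2, map_add, h0, zero_add]
    have := hgr (fun t => ‖u t‖ + ‖pb t‖) (fun t => C0 * (‖f t‖ + ‖g t‖)) (hu.norm.add hpb.norm)
      ((hf.norm.add hg.norm).const_mul C0) (fun t => by positivity) (fun t => by positivity) ?_
    · rw [integral_const_mul, integral_add hf.norm hg.norm] at this
      linarith
    · filter_upwards [hsl] with t ht
      refine (hest' _ _ _ _ _ _ ht.1 ht.2 (hdec t).1 (hdec t).2.1 (hdec t).2.2).trans ?_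
      have h1 := hmn u p pb hu hpb hfl t
      have h2 := norm_add_le (f t) (memT T a b κ₁ κ₂ u p t)
      calc C0 * (‖f t + memT T a b κ₁ κ₂ u p t‖ + ‖g t‖)
          ≤ C0 * ((‖f t‖ + (Ck1 * Na + Ck2 * Nb) * ∫ s, (if s ≤ t then (1:ℝ) else 0) *
            (‖u s‖ + ‖pb s‖) ∂μ) + ‖g t‖) := by gcongr; linarith
        _ = _ := by ring
  -- existence
  obtain ⟨S1, S2, S3, S4, hS⟩ := st_exists α₀ β Na hα₀ hβ hNa V Q a b hs hpos ha hco hB2 lam hlam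
  have i2 := S2.integrable_comp hg
  have i4 := S4.integrable_comp hg
  obtain ⟨x, hx, hxe⟩ := volt_exists T κ₁ κ₂ mk₁ mk₂ Ck1 Ck2 hCk1 hCk2 lk₁ lk₂
    (tk_zero T Ck1 k₁) (tk_zero T Ck2 k₂) (a.comp S1) (b.flip.comp S3) _
    (hf.add (hmi _ _ i2 i4))
  have i1 := S1.integrable_comp hx
  have i3 := S3.integrable_comp hx
  obtain ⟨u, hud⟩ : ∃ u : ℝ → V, u = fun t => S1 (x t) + S2 (g t) := ⟨_, rfl⟩
  obtain ⟨p, hpd⟩ : ∃ p : ℝ → Q, p = fun t => S3 (x t) + S4 (g t) := ⟨_, rfl⟩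
  have hu : Integrable u μ := by rw [hud]; exact i1.add i2
  have hp : Integrable p μ := by rw [hpd]; exact i3.add i4
  have hsl : ∀ᵐ t ∂μ, (∀ v, a (u t) v + b v (p t) = (f t + memT T a b κ₁ κ₂ u p t) v) ∧
      (∀ q, b (u t) q - lam * ⟪p t, q⟫ = g t q) := by
    filter_upwards [hxe] with t ht
    have : f t + memT T a b κ₁ κ₂ u p t = x t := by
      rw [hud, hpd, hma _ _ _ _ i1 i3 i2 i4, ht]
      simp only [Pi.add_apply]
      unfold memT
      simp only [ContinuousLinearMap.comp_apply]
      abel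
    rw [this, hud, hpd]
    exact hS (x t) (g t)
  have hproj : ∀ p : ℝ → Q, ∀ t, H.starProjection (p t) ∈ H ∧ p t - H.starProjection (p t) ∈ Hᗮ ∧
      p t = H.starProjection (p t) + (p t - H.starProjection (p t)) := fun p t =>
    ⟨H.starProjection_apply_mem _, H.sub_starProjection_mem_orthogonal _, by abel⟩
  refine ⟨u, p, hu, hp, (hsol _ _ _ _ hu hp).2 hsl, ?_, ?_⟩
  · intro u' p' hu' hp' hs'
    rw [hsol _ _ _ _ hu' hp'] at hs'
    rw [ae_Icc]
    have hdu : Integrable (fun t => u' t - u t) μ := hu'.sub hu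
    have hdp : Integrable (fun t => p' t - p t) μ := hp'.sub hp
    have hd : ∀ᵐ t ∂μ, (∀ v, a (u' t - u t) v + b v (p' t - p t) =
        ((0 : V →L[ℝ] ℝ) + memT T a b κ₁ κ₂ (fun t => u' t - u t) (fun t => p' t - p t) t) v) ∧
        (∀ q, b (u' t - u t) q - lam * ⟪p' t - p t, q⟫ = (0 : Q →L[ℝ] ℝ) q) := by
      filter_upwards [hsl, hs'] with t h1 h2
      refine ⟨fun v => ?_, fun q => ?_⟩
      · have e1 := h1.1 v
        have e2 := h2.1 v
        rw [hms _ _ _ _ hu' hp' hu hp]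
        simp only [map_sub, sub_apply, add_apply, zero_apply] at e1 e2 ⊢
        linarith
      · have e1 := h1.2 q
        have e2 := h2.2 q
        simp only [map_sub, sub_apply, zero_apply, inner_sub_left]
        linarith
    have hpb : Integrable (fun t => (p' t - p t) - H.starProjection (p' t - p t)) μ :=
      hdp.sub (H.starProjection.integrable_comp hdp)
    have h0 := apri (fun _ => 0) (fun _ => 0) _ _ _ _ (integrable_zero ℝ (V →L[ℝ] ℝ) μ) (integrable_zero ℝ (Q →L[ℝ] ℝ) μ)
      hdu hpb (hproj (fun t => p' t - p t)) hd
    simp only [norm_zero, integral_zero, add_zero, mul_zero] at h0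
    have h1 : ∫ t, (‖u' t - u t‖ + ‖(p' t - p t) - H.starProjection (p' t - p t)‖) ∂μ = 0 :=
      le_antisymm h0 (integral_nonneg fun t => by positivity)
    have hint : Integrable (fun t => ‖u' t - u t‖ +
        ‖(p' t - p t) - H.starProjection (p' t - p t)‖) μ := hdu.norm.add hpb.norm
    rw [integral_eq_zero_iff_of_nonneg
      (fun t => add_nonneg (norm_nonneg _) (norm_nonneg _)) hint] at h1
    filter_upwards [h1, hd] with t h2 h3
    simp only [Pi.zero_apply] at h2
    have n1 := norm_nonneg (u' t - u t)
    have n2 := norm_nonneg ((p' t - p t) - H.starProjection (p' t - p t))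
    have m := hproj (fun t => p' t - p t) t
    have h4 := st_p0 b lam hlam 0 0 _ _ _ _ h3.2 m.1 m.2.1 m.2.2 (fun _ _ => rfl)
    rw [norm_zero, mul_zero] at h4
    have h5 : H.starProjection (p' t - p t) = 0 := norm_le_zero_iff.1 h4
    have h6 : u' t - u t = 0 := norm_le_zero_iff.1 (by linarith)
    have h7 : (p' t - p t) - H.starProjection (p' t - p t) = 0 := norm_le_zero_iff.1 (by linarith)
    rw [h5, sub_zero] at h7
    exact ⟨sub_eq_zero.1 h6, sub_eq_zero.1 h7⟩
  · intro p₀ pbar g₀ hdec hg0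
    have hp0 : p₀ = fun t => H.starProjection (p t) := funext fun t =>
      (Submodule.eq_starProjection_of_mem_orthogonal' (hdec t).1 (hdec t).2.1 (hdec t).2.2).symm
    have ip0 : Integrable p₀ μ := by rw [hp0]; exact H.starProjection.integrable_comp hp
    have ipb : Integrable pbar μ := by
      have : pbar = fun t => p t - p₀ t := funext fun t => by rw [(hdec t).2.2]; abel
      rw [this]; exact hp.sub ip0
    have ig0 : Integrable g₀ μ := by
      have : g₀ = fun t => (ContinuousLinearMap.compL ℝ Q Q ℝ).flip H.starProjection (g t) := by
        ext t q
        have m := hproj (fun _ => q) t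
        have e : g₀ t q = g₀ t (H.starProjection q) + g₀ t (q - H.starProjection q) := by
          rw [← map_add]; congr 1; exact m.2.2
        rw [e, (hg0 t).1 _ m.1, (hg0 t).2 _ m.2.1, add_zero]
        rfl
      rw [this]
      exact ((ContinuousLinearMap.compL ℝ Q Q ℝ).flip H.starProjection).integrable_comp hg
    refine ⟨?_, ?_⟩
    · rw [← integral_add hu.norm ipb.norm]
      exact apri f g u p p₀ pbar hf hg hu ipb hdec hsl
    · rw [← integral_const_mul]
      refine integral_mono_ae ip0.norm (ig0.norm.const_mul _) ?_
      filter_upwards [hsl] with t ht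
      exact st_p0 b lam hlam (g t) (g₀ t) _ _ _ _ ht.2 (hdec t).1 (hdec t).2.1 (hdec t).2.2 (hg0 t).1
end
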